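/- arXiv:2503.11259 — 6 statements merged into one kernel-verified Lean document; each statement's English description precedes it below -/
import Mathlib

section
/- Fix 0 < α < 1/2. For all t > 0 and all ξ ∈ 𝕋 with |ξ| ≤ α one has exp(-πtξ²) ≤ θ_t(ξ)/θ_t(0) ≤ exp(-πtξ²) · exp( 2ξ² e^{-πt(1/4 - α/2)} / (1/2 - α)² ). Moreover, the lower bound exp(-πtξ²) ≤ θ_t(ξ)/θ_t(0) holds for all t > 0 and all ξ ∈ 𝕋. -/
open scoped ENNReal Real BigOperators
open Real

/-- The one-dimensional Theta function `θ_t(ζ) = Σ_{k∈ℤ} exp(-π(k-ζ)²t)`. -/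
noncomputable def theta (t ζ : ℝ) : ℝ :=
  ∑' k : ℤ, Real.exp (-π * ((k : ℝ) - ζ) ^ 2 * t)

/-- The d-dimensional Theta function `Θ_t(ξ) = Π_j θ_t(ξ_j)`. -/
noncomputable def bigTheta (d : ℕ) (t : ℝ) (ξ : Fin d → ℝ) : ℝ :=
  ∏ j, theta t (ξ j)

/-- The discrete normalized Gaussian kernel `g_t(n) = Θ_{1/t}(0)⁻¹ exp(-π|n|²/t)`. -/
noncomputable def gauss (d : ℕ) (t : ℝ) (n : Fin d → ℤ) : ℝ :=
  (bigTheta d (1 / t) 0)⁻¹ * Real.exp (-π * (∑ j, ((n j : ℝ)) ^ 2) / t)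

/-- The convolution operator `G_t f(x) = Σ_n g_t(n) f(x-n)` on ℤ^d. -/
noncomputable def gConv (d : ℕ) (t : ℝ) (f : (Fin d → ℤ) → ℂ) (x : Fin d → ℤ) : ℂ :=
  ∑' n : Fin d → ℤ, (gauss d t n : ℂ) * f (x - n)

/-- The ℓ^p norm (valued in ℝ≥0∞) of an ℝ≥0∞-valued function on ℤ^d. -/
noncomputable def lpNorm (d : ℕ) (p : ℝ) (F : (Fin d → ℤ) → ℝ≥0∞) : ℝ≥0∞ :=
  (∑' x : Fin d → ℤ, F x ^ p) ^ (1 / p)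

lemma aux_congr {ι : Type} {f g : ι → ℝ} {a : ℝ} (e : ∀ k, f k = g k) (h : HasSum g a) :
    HasSum f a := by
  rw [funext e]; exact h

lemma aux_theta_hasSum (t : ℝ) (ht : 0 < t) (ξ : ℝ) :
    HasSum (fun k : ℤ => Real.exp (-π * ((k : ℝ) - ξ) ^ 2 * t)) (theta t ξ) := by
  have h := (HurwitzZeta.hasSum_int_evenKernel (-ξ) ht).summable.hasSum
  simpa only [theta, sub_eq_add_neg] using h

lemma aux_theta_even (t : ℝ) (ht : 0 < t) (ξ : ℝ) :
    theta t ξ = HurwitzZeta.evenKernel ((-ξ : ℝ) : UnitAddCircle) t := by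
  have h := (HurwitzZeta.hasSum_int_evenKernel (-ξ) ht)
  refine (aux_theta_hasSum t ht ξ).unique ?_
  simpa only [sub_eq_add_neg] using h

lemma aux_theta_neg (t : ℝ) (ht : 0 < t) (ξ : ℝ) : theta t (-ξ) = theta t ξ := by
  rw [aux_theta_even t ht, aux_theta_even t ht]
  rw [AddCircle.coe_neg, HurwitzZeta.evenKernel_neg]

lemma aux_theta_le (t : ℝ) (ht : 0 < t) (ξ : ℝ) : theta t ξ ≤ theta t 0 := by
  rw [aux_theta_even t ht, aux_theta_even t ht, HurwitzZeta.evenKernel_functional_equation,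
    HurwitzZeta.evenKernel_functional_equation]
  have ht' : 0 < 1 / t := by positivity
  refine mul_le_mul_of_nonneg_left ?_ (by positivity)
  have h1 := HurwitzZeta.hasSum_int_cosKernel (-ξ) ht'
  have h0 := HurwitzZeta.hasSum_int_cosKernel (-0) ht'
  have h1' := Complex.hasSum_re h1
  have h0' := Complex.hasSum_re h0
  rw [Complex.ofReal_re] at h1' h0'
  refine hasSum_le (fun n => ?_) h1' h0'
  rw [Complex.re_mul_ofReal, Complex.re_mul_ofReal]
  refine mul_le_mul_of_nonneg_right ?_ (Real.exp_pos _).le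
  refine (Complex.re_le_norm _).trans ?_
  rw [Complex.norm_exp]
  simp

lemma aux_theta_cosh (t : ℝ) (ht : 0 < t) (ξ : ℝ) :
    HasSum (fun k : ℤ => Real.exp (-π * ((k : ℝ) - 0) ^ 2 * t) * Real.cosh (2 * π * t * k * ξ))
      (Real.exp (π * t * ξ ^ 2) * theta t ξ) := by
  have h1 := aux_theta_hasSum t ht ξ
  have h2 := aux_theta_hasSum t ht (-ξ)
  rw [aux_theta_neg t ht] at h2
  have h := (h1.add h2).mul_left (Real.exp (π * t * ξ ^ 2) / 2)
  rw [show Real.exp (π * t * ξ ^ 2) * theta t ξ =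
    Real.exp (π * t * ξ ^ 2) / 2 * (theta t ξ + theta t ξ) by ring]
  refine aux_congr (fun k => ?_) h
  · rw [Real.cosh_eq, div_mul_eq_mul_div, mul_add, mul_div_assoc', mul_add,
      ← Real.exp_add, ← Real.exp_add, ← Real.exp_add, ← Real.exp_add]
    congr 3 <;> ring

lemma aux_theta_zero (t : ℝ) (ht : 0 < t) : 1 ≤ theta t 0 := by
  have h := (aux_theta_hasSum t ht 0)
  have := le_hasSum h 0 (fun j _ => (Real.exp_pos _).le)
  simpa using this

lemma aux_lower (t : ℝ) (ht : 0 < t) (ξ : ℝ) :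
    Real.exp (-π * t * ξ ^ 2) ≤ theta t ξ / theta t 0 := by
  have h0 := aux_theta_zero t ht
  rw [le_div_iff₀ (by linarith)]
  have h : theta t 0 ≤ Real.exp (π * t * ξ ^ 2) * theta t ξ :=
    hasSum_le (fun k => le_mul_of_one_le_right (Real.exp_pos _).le (Real.one_le_cosh _))
      (aux_theta_hasSum t ht 0) (aux_theta_cosh t ht ξ)
  calc _ ≤ Real.exp (-π * t * ξ ^ 2) * (Real.exp (π * t * ξ ^ 2) * theta t ξ) := by gcongr
    _ = _ := by
      rw [← mul_assoc, ← Real.exp_add]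
      ring_nf
      simp

lemma aux_cosh (x : ℝ) : Real.cosh x ≤ 1 + x ^ 2 / 2 * Real.exp |x| := by
  rw [← Real.cosh_abs, ← sq_abs x]
  have hx := abs_nonneg x
  generalize |x| = y at hx
  have h1 : Real.cosh y = 1 + 2 * Real.sinh (y / 2) ^ 2 := by
    have := Real.cosh_two_mul (y / 2)
    rw [Real.cosh_sq, mul_div_cancel₀ y (by norm_num : (2:ℝ) ≠ 0)] at this
    linarith
  have h2 : Real.sinh (y / 2) ≤ y / 2 * Real.exp (y / 2) := by
    rw [Real.sinh_eq]
    have h3 := Real.add_one_le_exp (-y)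
    have h4 : Real.exp (-(y / 2)) = Real.exp (-y) * Real.exp (y / 2) := by
      rw [← Real.exp_add]; ring_nf
    rw [h4]
    nlinarith [Real.exp_pos (y / 2)]
  have h5 : 0 ≤ Real.sinh (y / 2) := Real.sinh_nonneg_iff.2 (by linarith)
  have h6 : Real.exp y = Real.exp (y / 2) ^ 2 := by
    rw [← Real.exp_nat_mul]; ring_nf
  rw [h1, h6]
  have := pow_le_pow_left₀ h5 h2 2
  nlinarith

lemma aux_sq (y : ℝ) (hy : 0 ≤ y) : y ^ 2 ≤ 3 / 4 * Real.exp y := by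
  have h1 := Real.add_one_le_exp (y / 2 - 1)
  have h2 : Real.exp (y / 2) = Real.exp (y / 2 - 1) * Real.exp 1 := by
    rw [← Real.exp_add]; ring_nf
  have h3 : (2.7:ℝ) ≤ Real.exp 1 := by linarith [Real.exp_one_gt_d9]
  have h6 : Real.exp y = Real.exp (y / 2) ^ 2 := by
    rw [← Real.exp_nat_mul]; ring_nf
  have h7 : 2.7 * (y / 2) ≤ Real.exp (y / 2) := by
    rw [h2]; nlinarith
  rw [h6]
  nlinarith [pow_le_pow_left₀ (by positivity) h7 2, sq_nonneg y]

lemma aux_term (α : ℝ) (hα : α < 1/2) (t : ℝ) (ht : 0 < t) (ξ : ℝ)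
    (hξ : |ξ| ≤ α) (k : ℤ) :
    Real.exp (-π * ((k : ℝ) - 0) ^ 2 * t) * Real.cosh (2 * π * t * k * ξ) ≤
      Real.exp (-π * ((k : ℝ) - 0) ^ 2 * t) +
      (if k = 0 then 0 else 3 / 2 * ξ ^ 2 / (1/2 - α) ^ 2 *
        Real.exp (-(π * t * (1/2 - α))) ^ k.natAbs) := by
  split_ifs with hk
  · simp [hk]
  have hb : 0 < 1/2 - α := by linarith
  have hp := Real.pi_pos
  have hkn : ((k.natAbs : ℕ) : ℝ) = |(k:ℝ)| := by
    rw [Nat.cast_natAbs]; simp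
  have hk1 : 1 ≤ |(k:ℝ)| := by
    rw [← hkn]; exact_mod_cast Int.natAbs_pos.2 hk
  rw [← Real.exp_nat_mul, hkn, sub_zero, ← sq_abs (k:ℝ)]
  have hc := aux_cosh (2 * π * t * k * ξ)
  have habs : |2 * π * t * k * ξ| = 2 * π * t * |(k:ℝ)| * |ξ| := by
    rw [abs_mul, abs_mul, abs_of_pos (by positivity : 0 < 2 * π * t)]
  rw [habs, ← sq_abs (2 * π * t * k * ξ), habs] at hc
  rw [← sq_abs ξ]
  have hξ0 := abs_nonneg ξ
  generalize |ξ| = z at *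
  generalize |(k:ℝ)| = n at *
  have hn : 0 < n := by linarith
  have hy := aux_sq (π * t * (1/2 - α) * n) (by positivity)
  have he : Real.exp (-π * n ^ 2 * t) * Real.exp (2 * π * t * n * z) ≤
      Real.exp (-(2 * (π * t * (1/2 - α) * n))) := by
    rw [← Real.exp_add]
    apply Real.exp_le_exp.2
    have h1 : n * z ≤ n * α := by gcongr
    have h2 : n ≤ n ^ 2 := by nlinarith
    have h3 : -n^2 + 2 * n * z ≤ -(2 * ((1/2 - α) * n)) := by nlinarith
    have := mul_le_mul_of_nonneg_left h3 (by positivity : 0 ≤ π * t)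
    nlinarith
  calc _ ≤ Real.exp (-π * n ^ 2 * t) *
        (1 + (2 * π * t * n * z) ^ 2 / 2 * Real.exp (2 * π * t * n * z)) := by gcongr
    _ = Real.exp (-π * n ^ 2 * t) + (2 * π * t * n * z) ^ 2 / 2 *
        (Real.exp (-π * n ^ 2 * t) * Real.exp (2 * π * t * n * z)) := by ring
    _ ≤ Real.exp (-π * n ^ 2 * t) + (2 * π * t * n * z) ^ 2 / 2 *
        Real.exp (-(2 * (π * t * (1/2 - α) * n))) := by gcongr
    _ = Real.exp (-π * n ^ 2 * t) + 2 * z ^ 2 / (1/2 - α) ^ 2 *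
        ((π * t * (1/2 - α) * n) ^ 2 * Real.exp (-(2 * (π * t * (1/2 - α) * n)))) := by
      have hb' := hb.ne'
      generalize 1/2 - α = b at hb'
      field_simp
    _ ≤ Real.exp (-π * n ^ 2 * t) + 2 * z ^ 2 / (1/2 - α) ^ 2 *
        ((3 / 4 * Real.exp (π * t * (1/2 - α) * n)) *
          Real.exp (-(2 * (π * t * (1/2 - α) * n)))) := by gcongr
    _ = _ := by
      rw [mul_assoc (3 / 4 : ℝ), ← Real.exp_add]
      ring_nf

lemma aux_geom (A q : ℝ) (hq0 : 0 ≤ q) (hq : q < 1) :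
    HasSum (fun k : ℤ => if k = 0 then 0 else A * q ^ k.natAbs) (2 * A * (q / (1 - q))) := by
  have h : HasSum (fun n : ℕ => A * q ^ (n + 1)) (A * (q / (1 - q))) := by
    have := (hasSum_geometric_of_lt_one hq0 hq).mul_left (A * q)
    rw [show A * (q / (1 - q)) = A * q * (1 - q)⁻¹ by ring]
    exact aux_congr (fun n => by ring) this
  have h2 := HasSum.of_add_one_of_neg_add_one
    (f := fun k : ℤ => if k = 0 then 0 else A * q ^ k.natAbs)
    (m := A * (q / (1 - q))) (m' := A * (q / (1 - q))) ?_ ?_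
  · convert h2 using 1
    simp; ring
  · convert h using 2 with n
    rw [if_neg (by omega)]
    congr 2
  · convert h using 2 with n
    rw [if_neg (by omega)]
    congr 2

lemma aux_upper (α : ℝ) (hα0 : 0 < α) (hα : α < 1/2) (t : ℝ) (ht : 0 < t) (ξ : ℝ)
    (hξ : |ξ| ≤ α) :
    Real.exp (π * t * ξ ^ 2) * theta t ξ ≤ theta t 0 *
      Real.exp (2 * ξ ^ 2 * Real.exp (-π * t * (1/4 - α/2)) / (1/2 - α) ^ 2) := by
  have h0 := aux_theta_zero t ht
  have hp := Real.pi_pos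
  have hb : 0 < 1/2 - α := by linarith
  have hexp : -π * t * (1/4 - α/2) = -(π * t * (1/2 - α) / 2) := by ring
  rw [hexp]
  set s := π * t * (1/2 - α) with hs
  have hspos : 0 < s := by positivity
  rcases le_total s (3/2) with h | h
  · have hle := aux_theta_le t ht ξ
    rw [mul_comm]
    refine mul_le_mul hle (Real.exp_le_exp.2 ?_) (Real.exp_pos _).le (by linarith)
    rw [le_div_iff₀ (by positivity)]
    have h1 : s * (1/2 - α) ≤ 3/4 := by nlinarith
    have h2 : (3/8 : ℝ) ≤ Real.exp (-(s / 2)) := by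
      have h3 := Real.add_one_le_exp (-(3/8) : ℝ)
      have h4 : Real.exp (-(3/8) : ℝ) ^ 2 = Real.exp (-(3/4)) := by
        rw [← Real.exp_nat_mul]; norm_num
      have h5 : Real.exp (-(3/4)) ≤ Real.exp (-(s / 2)) := Real.exp_le_exp.2 (by linarith)
      nlinarith
    have h6 : π * t * ξ ^ 2 * (1/2 - α) ^ 2 = ξ ^ 2 * (s * (1/2 - α)) := by rw [hs]; ring
    rw [h6]
    nlinarith [sq_nonneg ξ]
  · set r := Real.exp (-(s / 2)) with hr
    have hr0 : 0 < r := Real.exp_pos _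
    have hr2 : r ≤ 1 / 2 := by
      have h1 := Real.quadratic_le_exp_of_nonneg (x := s / 2) (by positivity)
      rw [hr, Real.exp_neg, ← one_div]
      apply one_div_le_one_div_of_le (by norm_num)
      nlinarith
    have hq : Real.exp (-s) = r ^ 2 := by
      rw [hr, ← Real.exp_nat_mul]; ring_nf
    have hq1 : r ^ 2 < 1 := by nlinarith
    have hg := aux_geom (3 / 2 * ξ ^ 2 / (1/2 - α) ^ 2) (r ^ 2) (by positivity) hq1
    have hsum := hasSum_le (fun k => aux_term α hα t ht ξ hξ k) (aux_theta_cosh t ht ξ)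
      ((aux_theta_hasSum t ht 0).add (by rw [← hs, hq]; exact hg))
    set δ := 2 * ξ ^ 2 * r / (1/2 - α) ^ 2 with hδ
    have hδ0 : 0 ≤ δ := by positivity
    have hfrac : 3 / 2 * (r ^ 2 / (1 - r ^ 2)) ≤ r := by
      rw [mul_div_assoc', div_le_iff₀ (by linarith)]
      nlinarith [mul_nonneg hr0.le (sub_nonneg.2 hr2)]
    have hle : 2 * (3 / 2 * ξ ^ 2 / (1/2 - α) ^ 2) * (r ^ 2 / (1 - r ^ 2)) ≤ δ := by
      have := mul_le_mul_of_nonneg_left hfrac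
        (by positivity : 0 ≤ 2 * ξ ^ 2 / (1/2 - α) ^ 2)
      calc _ = 2 * ξ ^ 2 / (1/2 - α) ^ 2 * (3 / 2 * (r ^ 2 / (1 - r ^ 2))) := by ring
        _ ≤ _ := this
        _ = δ := by rw [hδ]; ring
    have he := Real.add_one_le_exp δ
    nlinarith

/-- Two-sided Gaussian bound for the ratio `θ_t(ξ)/θ_t(0)`: fix `0 < α < 1/2`; for all `t > 0`
and `ξ ∈ 𝕋` with `|ξ| ≤ α`,
`exp(-πtξ²) ≤ θ_t(ξ)/θ_t(0) ≤ exp(-πtξ²) exp(2ξ² e^{-πt(1/4-α/2)}/(1/2-α)²)`;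
moreover the lower bound holds for all `t > 0` and `ξ ∈ 𝕋`. -/
theorem theta_ratio_gaussian_bounds (α : ℝ) (hα0 : 0 < α) (hα : α < 1/2) :
    (∀ t : ℝ, 0 < t → ∀ ξ : ℝ, ξ ∈ Set.Ico (-(1/2) : ℝ) (1/2) → |ξ| ≤ α →
      Real.exp (-π * t * ξ ^ 2) ≤ theta t ξ / theta t 0 ∧
        theta t ξ / theta t 0 ≤ Real.exp (-π * t * ξ ^ 2) *
          Real.exp (2 * ξ ^ 2 * Real.exp (-π * t * (1/4 - α/2)) / (1/2 - α) ^ 2)) ∧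
    (∀ t : ℝ, 0 < t → ∀ ξ : ℝ, ξ ∈ Set.Ico (-(1/2) : ℝ) (1/2) →
      Real.exp (-π * t * ξ ^ 2) ≤ theta t ξ / theta t 0) := by
  refine ⟨fun t ht ξ _ hξ => ⟨aux_lower t ht ξ, ?_⟩, fun t ht ξ _ => aux_lower t ht ξ⟩
  have h0 := aux_theta_zero t ht
  have h := aux_upper α hα0 hα t ht ξ hξ
  rw [div_le_iff₀ (by linarith)]
  have h1 : theta t ξ = Real.exp (-π * t * ξ ^ 2) * (Real.exp (π * t * ξ ^ 2) * theta t ξ) := by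
    rw [← mul_assoc, ← Real.exp_add]
    ring_nf
    simp
  rw [h1, mul_assoc (Real.exp (-π * t * ξ ^ 2))]
  refine mul_le_mul_of_nonneg_left ?_ (Real.exp_pos _).le
  linarith
end

section
/- For each t ≥ 15 and each ξ ∈ 𝕋 one has θ_t(ξ)/θ_t(0) ≤ exp(-πtξ²/10). -/
open scoped ENNReal Real BigOperators
open Real

theorem cosh_aux (c x : ℝ) (hc : c ^ 2 ≤ 1) :
    Real.cosh (c * x) ≤ 1 + c ^ 2 * Real.cosh x := by
  have h1 := Real.hasSum_cosh (c * x)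
  have h2 := ((Real.hasSum_cosh x).mul_left (c ^ 2)).add (hasSum_ite_eq (0 : ℕ) (1 : ℝ))
  rw [add_comm 1]
  refine hasSum_le (fun n => ?_) h1 h2
  rcases n with _ | n
  · simp; positivity
  · have h3 : (c ^ 2) ^ n ≤ 1 := pow_le_one₀ (sq_nonneg c) hc
    have h4 : 0 ≤ c ^ 2 * (x ^ (2 * (n + 1)) / ((2 * (n + 1)).factorial : ℝ)) := by
      have : 0 ≤ x ^ (2 * (n + 1)) := by rw [pow_mul]; positivity
      positivity
    have h5 : (c * x) ^ (2 * (n + 1)) / ((2 * (n + 1)).factorial : ℝ)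
        = (c ^ 2) ^ n * (c ^ 2 * (x ^ (2 * (n + 1)) / ((2 * (n + 1)).factorial : ℝ))) := by
      rw [mul_pow, ← pow_mul]; ring
    rw [h5]
    simp only [Nat.add_eq_zero_iff, one_ne_zero, and_false, if_false, add_zero]
    nlinarith

theorem g_aux (s : ℝ) (hs : 1 ≤ s) :
    Summable (fun k : ℤ => Real.exp (-s * ((k : ℝ) ^ 2 + k))) ∧
    ∑' k : ℤ, Real.exp (-s * ((k : ℝ) ^ 2 + k)) ≤ 4 := by
  have hb : ∀ n : ℕ, Real.exp (-s * ((n : ℝ) ^ 2 + n)) ≤ (1 / 2 : ℝ) ^ n := by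
    intro n
    have h1 : Real.exp (-s * ((n : ℝ) ^ 2 + n)) ≤ Real.exp (n * (-1)) := by
      apply Real.exp_le_exp.2
      have : (0 : ℝ) ≤ n := n.cast_nonneg
      nlinarith [mul_nonneg (sub_nonneg.2 hs) this, mul_nonneg (by linarith : 0 ≤ s) (sq_nonneg (n : ℝ))]
    refine h1.trans ?_
    rw [Real.exp_nat_mul]
    apply pow_le_pow_left₀ (Real.exp_pos _).le
    rw [Real.exp_neg, one_div]
    apply inv_anti₀ (by norm_num)
    have := Real.add_one_le_exp (1 : ℝ)
    linarith
  have hs1 : Summable (fun n : ℕ => Real.exp (-s * ((n : ℝ) ^ 2 + n))) :=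
    Summable.of_nonneg_of_le (fun n => (Real.exp_pos _).le) hb summable_geometric_two
  have ht1 : ∑' n : ℕ, Real.exp (-s * ((n : ℝ) ^ 2 + n)) ≤ 2 := by
    rw [← tsum_geometric_two]
    exact hs1.tsum_le_tsum hb summable_geometric_two
  have e1 : HasSum (fun n : ℕ => Real.exp (-s * ((((n : ℤ)) : ℝ) ^ 2 + ((n : ℤ) : ℝ))))
      (∑' n : ℕ, Real.exp (-s * ((n : ℝ) ^ 2 + n))) := by
    simpa using hs1.hasSum
  have e2 : HasSum (fun n : ℕ => Real.exp (-s * (((-((n : ℤ) + 1) : ℤ) : ℝ) ^ 2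
      + ((-((n : ℤ) + 1) : ℤ) : ℝ))))
      (∑' n : ℕ, Real.exp (-s * ((n : ℝ) ^ 2 + n))) := by
    convert hs1.hasSum using 3 with n
    push_cast; ring
  have := HasSum.of_nat_of_neg_add_one (f := fun k : ℤ => Real.exp (-s * ((k : ℝ) ^ 2 + k))) e1 e2
  refine ⟨this.summable, ?_⟩
  rw [this.tsum_eq]; linarith

theorem pair_aux (s k ξ : ℝ) (hξ : (2 * ξ) ^ 2 ≤ 1) :
    Real.exp (-s * (k - ξ) ^ 2) + Real.exp (-s * (-k - ξ) ^ 2) ≤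
    Real.exp (-s * ξ ^ 2) * (2 * Real.exp (-s * k ^ 2) + 4 * ξ ^ 2 *
      (Real.exp (-s * (k ^ 2 + k)) + Real.exp (-s * ((-k) ^ 2 + -k)))) := by
  have h := cosh_aux (2 * ξ) (s * k) hξ
  rw [Real.cosh_eq, Real.cosh_eq] at h
  have a1 : Real.exp (-s * (k - ξ) ^ 2) = Real.exp (-s * ξ ^ 2) * (Real.exp (-s * k ^ 2) *
      Real.exp (2 * ξ * (s * k))) := by
    rw [← Real.exp_add, ← Real.exp_add]; ring_nf
  have a2 : Real.exp (-s * (-k - ξ) ^ 2) = Real.exp (-s * ξ ^ 2) * (Real.exp (-s * k ^ 2) *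
      Real.exp (-(2 * ξ * (s * k)))) := by
    rw [← Real.exp_add, ← Real.exp_add]; ring_nf
  have a3 : Real.exp (-s * (k ^ 2 + k)) = Real.exp (-s * k ^ 2) * Real.exp (-(s * k)) := by
    rw [← Real.exp_add]; ring_nf
  have a4 : Real.exp (-s * ((-k) ^ 2 + -k)) = Real.exp (-s * k ^ 2) * Real.exp (s * k) := by
    rw [← Real.exp_add]; ring_nf
  rw [a1, a2, a3, a4, ← mul_add]
  apply mul_le_mul_of_nonneg_left _ (Real.exp_pos _).le
  have := mul_le_mul_of_nonneg_left h (Real.exp_pos (-s * k ^ 2)).le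
  linarith

/-- For each `t ≥ 15` and `ξ ∈ 𝕋` one has `θ_t(ξ)/θ_t(0) ≤ exp(-πtξ²/10)`. -/
theorem theta_ratio_large_scales (t : ℝ) (ht : 15 ≤ t) (ξ : ℝ)
    (hξ : ξ ∈ Set.Ico (-(1/2) : ℝ) (1/2)) :
    theta t ξ / theta t 0 ≤ Real.exp (-π * t * ξ ^ 2 / 10) := by
  obtain ⟨h1, h2⟩ := hξ
  have hπ := Real.pi_gt_three
  obtain ⟨s, hs⟩ : ∃ s, s = π * t := ⟨_, rfl⟩
  have hs45 : 45 ≤ s := by rw [hs]; nlinarith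
  have hx : (2 * ξ) ^ 2 ≤ 1 := by nlinarith
  obtain ⟨g1, g2⟩ := g_aux s (by linarith)
  have th : ∀ ζ, theta t ζ = ∑' k : ℤ, Real.exp (-s * ((k : ℝ) - ζ) ^ 2) := by
    intro ζ
    unfold theta
    congr 1; ext k; rw [hs]; ring_nf
  have g1' : Summable (fun k : ℤ => Real.exp (-s * ((-(k : ℝ)) ^ 2 + -(k : ℝ)))) := by
    have := (Equiv.neg ℤ).summable_iff.2 g1
    simpa [Function.comp_def] using this
  have g2' : ∑' k : ℤ, Real.exp (-s * ((-(k : ℝ)) ^ 2 + -(k : ℝ))) ≤ 4 := by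
    have := (Equiv.neg ℤ).tsum_eq (fun k : ℤ => Real.exp (-s * ((k : ℝ) ^ 2 + k)))
    simp only [Equiv.neg_apply, Int.cast_neg] at this
    rw [this]; exact g2
  have z1 : Summable (fun k : ℤ => Real.exp (-s * (k : ℝ) ^ 2)) := by
    refine Summable.of_nonneg_of_le (fun k => (Real.exp_pos _).le) (fun k => ?_) (g1.add g1')
    rcases le_total 0 (k : ℝ) with hk | hk
    · refine le_trans (Real.exp_le_exp.2 ?_) (le_add_of_nonneg_left (Real.exp_pos _).le)
      nlinarith
    · refine le_trans (Real.exp_le_exp.2 ?_) (le_add_of_nonneg_right (Real.exp_pos _).le)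
      nlinarith
  have hR := (((z1.mul_left 2).add ((g1.add g1').mul_left (4 * ξ ^ 2))).mul_left
    (Real.exp (-s * ξ ^ 2)))
  have hF : Summable (fun k : ℤ => Real.exp (-s * ((k : ℝ) - ξ) ^ 2)) :=
    Summable.of_nonneg_of_le (fun k => (Real.exp_pos _).le)
      (fun k => (le_add_of_nonneg_right (Real.exp_pos _).le).trans (pair_aux s k ξ hx)) hR
  have hF' : Summable (fun k : ℤ => Real.exp (-s * (-(k : ℝ) - ξ) ^ 2)) := by
    have := (Equiv.neg ℤ).summable_iff.2 hF
    simpa [Function.comp_def] using this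
  have eF : ∑' k : ℤ, Real.exp (-s * (-(k : ℝ) - ξ) ^ 2) = theta t ξ := by
    rw [th]
    have := (Equiv.neg ℤ).tsum_eq (fun k : ℤ => Real.exp (-s * ((k : ℝ) - ξ) ^ 2))
    simpa only [Equiv.neg_apply, Int.cast_neg] using this
  have e0 : theta t 0 = ∑' k : ℤ, Real.exp (-s * (k : ℝ) ^ 2) := by
    rw [th]; simp only [sub_zero]
  have main := (hF.add hF').tsum_le_tsum (fun k : ℤ => pair_aux s k ξ hx) hR
  rw [hF.tsum_add hF', ← th, eF, tsum_mul_left,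
    (z1.mul_left 2).tsum_add ((g1.add g1').mul_left (4 * ξ ^ 2)), tsum_mul_left, tsum_mul_left,
    g1.tsum_add g1', ← e0] at main
  have one : 1 ≤ theta t 0 := by
    rw [e0]
    have := z1.le_tsum 0 (fun k _ => (Real.exp_pos _).le)
    simpa using this
  rw [div_le_iff₀ (by linarith)]
  have hE := Real.exp_pos (-s * ξ ^ 2)
  have b1 : theta t ξ ≤ Real.exp (-s * ξ ^ 2) * ((1 + 16 * ξ ^ 2) * theta t 0) := by
    have : 2 * theta t 0 + 4 * ξ ^ 2 * (∑' k : ℤ, Real.exp (-s * ((k : ℝ) ^ 2 + k))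
        + ∑' k : ℤ, Real.exp (-s * ((-(k : ℝ)) ^ 2 + -(k : ℝ))))
        ≤ 2 * ((1 + 16 * ξ ^ 2) * theta t 0) := by
      nlinarith [mul_le_mul_of_nonneg_left (add_le_add g2 g2') (sq_nonneg ξ),
        mul_le_mul_of_nonneg_left one (sq_nonneg ξ)]
    have := mul_le_mul_of_nonneg_left this hE.le
    linarith
  refine b1.trans ?_
  rw [← mul_assoc]
  apply mul_le_mul_of_nonneg_right _ (by linarith)
  have b2 : 1 + 16 * ξ ^ 2 ≤ Real.exp (16 * ξ ^ 2) := by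
    linarith [Real.add_one_le_exp (16 * ξ ^ 2)]
  refine (mul_le_mul_of_nonneg_left b2 hE.le).trans ?_
  rw [← Real.exp_add]
  apply Real.exp_le_exp.2
  have : -π * t * ξ ^ 2 / 10 = -s * ξ ^ 2 / 10 := by rw [hs]; ring
  rw [this]
  nlinarith [mul_le_mul_of_nonneg_right hs45 (sq_nonneg ξ)]
end

section
/- For each n ∈ ℕ there exists a constant C_n > 0 such that for all t > 1 and all ξ ∈ 𝕋 one has | t^n ∂_t^n ( θ_t(ξ)/θ_t(0) ) | ≤ C_n ( t^n ξ^{2n} + ξ² e^{-πt/5} ) · exp(-πtξ²/5), where ∂_t^n denotes the n-th derivative in t of the smooth function t ↦ θ_t(ξ)/θ_t(0) on (0,∞). -/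
open scoped ENNReal Real BigOperators
open Real

noncomputable def cT (ξ : ℝ) (z : ℂ) : ℂ :=
  ∑' k : ℤ, Complex.exp ((-π * ((k : ℝ) - ξ) ^ 2 : ℝ) * z)

lemma summ_u : Summable (fun k : ℤ => Real.exp (-π * (k:ℝ) ^ 2 / 8)) := by
  have key : Summable (fun n : ℕ => Real.exp (-π * (n:ℝ) ^ 2 / 8)) := by
    have h : Summable (fun n : ℕ => Real.exp (n * (-π / 8))) :=
      Real.summable_exp_nat_mul_iff.2 (by linarith [Real.pi_pos])
    refine Summable.of_nonneg_of_le (fun n => (Real.exp_pos _).le) (fun n => ?_) h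
    apply Real.exp_le_exp.2
    have h1 : (n:ℝ) ≤ (n:ℝ)^2 := by
      exact_mod_cast Nat.le_self_pow two_ne_zero n
    nlinarith [Real.pi_pos, mul_le_mul_of_nonneg_left h1 Real.pi_pos.le]
  refine Summable.of_nat_of_neg ?_ ?_
  · simpa using key
  · simpa using key

lemma int_sq_le (k : ℤ) : |(k:ℝ)| ≤ (k:ℝ)^2 := by
  rcases eq_or_ne k 0 with h | h
  · simp [h]
  · have : (1:ℝ) ≤ |(k:ℝ)| := by exact_mod_cast Int.one_le_abs h
    rw [← sq_abs]; nlinarith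

lemma sq_shift1 (k : ℤ) (ξ : ℝ) (h : |ξ| ≤ 1/2) : ξ^2 ≤ ((k:ℝ) - ξ)^2 := by
  have h1 := int_sq_le k
  have h2 : (k:ℝ) * ξ ≤ |(k:ℝ)| * |ξ| := by rw [← abs_mul]; exact le_abs_self _
  nlinarith [abs_nonneg (k:ℝ), mul_le_mul_of_nonneg_left h (abs_nonneg (k:ℝ))]

lemma sq_shift2 (k : ℤ) (ξ : ℝ) (h : |ξ| ≤ 1/2) : (k:ℝ)^2/4 ≤ ((k:ℝ) - ξ)^2 := by
  rcases eq_or_ne k 0 with h0 | h0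
  · simp [h0]; positivity
  · have h1 : (1:ℝ) ≤ |(k:ℝ)| := by exact_mod_cast Int.one_le_abs h0
    have h2 : (k:ℝ) * ξ ≤ |(k:ℝ)| * |ξ| := by rw [← abs_mul]; exact le_abs_self _
    have h3 := sq_abs (k:ℝ)
    have h4 := sq_abs ξ
    have h5 : |(k:ℝ)|/2 ≤ |(k:ℝ)| - |ξ| := by linarith
    have h6 : (|(k:ℝ)|/2)^2 ≤ (|(k:ℝ)| - |ξ|)^2 := pow_le_pow_left₀ (by positivity) h5 2
    nlinarith

lemma term_norm (a : ℝ) (z : ℂ) : ‖Complex.exp ((a:ℂ) * z)‖ = Real.exp (a * z.re) := by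
  rw [Complex.norm_exp, Complex.re_ofReal_mul]

lemma term_bound (k : ℤ) (ξ : ℝ) (h : |ξ| ≤ 1/2) (z : ℂ) (hz : 1/2 < z.re) :
    ‖Complex.exp ((-π * ((k : ℝ) - ξ) ^ 2 : ℝ) * z)‖ ≤ Real.exp (-π * (k:ℝ)^2 / 8) := by
  rw [term_norm]
  apply Real.exp_le_exp.2
  have := sq_shift2 k ξ h
  have h2 : (k:ℝ)^2/4 * (1/2) ≤ ((k:ℝ) - ξ)^2 * z.re :=
    mul_le_mul this hz.le (by norm_num) (by positivity)
  nlinarith [Real.pi_pos, mul_le_mul_of_nonneg_left h2 Real.pi_pos.le]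

lemma cT_summable (ξ : ℝ) (h : |ξ| ≤ 1/2) (z : ℂ) (hz : 1/2 < z.re) :
    Summable (fun k : ℤ => Complex.exp ((-π * ((k : ℝ) - ξ) ^ 2 : ℝ) * z)) :=
  Summable.of_norm_bounded summ_u (fun k => term_bound k ξ h z hz)

lemma U_open : IsOpen {z : ℂ | 1/2 < z.re} := isOpen_lt continuous_const Complex.continuous_re

lemma cT_diff (ξ : ℝ) (h : |ξ| ≤ 1/2) : DifferentiableOn ℂ (cT ξ) {z : ℂ | 1/2 < z.re} := by
  unfold cT
  refine Complex.differentiableOn_tsum_of_summable_norm summ_u (fun k => ?_) U_open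
    (fun k z hz => term_bound k ξ h z hz)
  fun_prop

lemma cT_real (ξ s : ℝ) : cT ξ (s:ℂ) = ((theta s ξ : ℝ) : ℂ) := by
  unfold cT theta
  push_cast
  rfl

lemma cT_zero_lower (z : ℂ) (hz : 1/2 < z.re) : 1/3 ≤ ‖cT 0 z‖ := by
  have hs := cT_summable 0 (by norm_num) z hz
  have hq : Real.exp (-(π/2)) ≤ 1/4 := by
    have h1 : (4:ℝ) ≤ Real.exp (3/2) := by
      have h2 : Real.exp (3/2) ^ 2 = Real.exp 1 ^ 3 := by
        rw [← Real.exp_nat_mul, ← Real.exp_nat_mul]; norm_num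
      have h3 := Real.exp_one_gt_d9
      have h4 : (2.7:ℝ)^3 ≤ Real.exp 1 ^ 3 := pow_le_pow_left₀ (by norm_num) (by linarith) 3
      have := Real.exp_pos (3/2)
      nlinarith
    have h5 : Real.exp (3/2) ≤ Real.exp (π/2) := Real.exp_le_exp.2 (by linarith [Real.pi_gt_three])
    rw [Real.exp_neg, ← one_div]
    exact one_div_le_one_div_of_le (by norm_num) (h1.trans h5)
  have hg : HasSum (fun k : ℤ => if k = 0 then (0:ℝ) else (1/4:ℝ)^k.natAbs) (1/3 + 1/3) := by
    have hgeo := (hasSum_geometric_of_lt_one (r := (1/4:ℝ)) (by norm_num) (by norm_num)).mul_left (1/4)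
    have hgeo' : HasSum (fun n : ℕ => (1/4:ℝ) * (1/4)^n) (1/3) := by
      have e : (1/4:ℝ) * (1 - 1/4)⁻¹ = 1/3 := by norm_num
      rwa [e] at hgeo
    refine HasSum.of_nat_of_neg_add_one ?_ ?_
    · rw [← hasSum_nat_add_iff' 1]
      have e0 : (1/3:ℝ) - ∑ i ∈ Finset.range 1, (if (i:ℤ) = 0 then (0:ℝ) else (1/4:ℝ)^(i:ℤ).natAbs) = 1/3 := by
        simp
      rw [e0]
      refine (congrArg (fun f => HasSum f (1/3:ℝ)) (funext fun n => ?_)).mpr hgeo'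
      have : ((n+1 : ℕ):ℤ) ≠ 0 := by omega
      rw [if_neg this, Int.natAbs_natCast, pow_succ]; ring
    · refine (congrArg (fun f => HasSum f (1/3:ℝ)) (funext fun n => ?_)).mpr hgeo'
      have h1 : (-((n:ℤ)+1)) ≠ 0 := by omega
      have h2 : (-((n:ℤ)+1)).natAbs = n+1 := by omega
      rw [if_neg h1, h2, pow_succ]; ring
  have hb : ‖∑' k : ℤ, (if k = 0 then (0:ℂ) else Complex.exp ((-π * ((k : ℝ) - (0:ℝ)) ^ 2 : ℝ) * z))‖ ≤ 1/3+1/3 := by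
    refine tsum_of_norm_bounded hg (fun k => ?_)
    split_ifs with hk
    · simp
    · rw [term_norm]
      have h1 : Real.exp (-π * ((k:ℝ) - 0)^2 * z.re) ≤ Real.exp (k.natAbs * (-(π/2))) := by
        apply Real.exp_le_exp.2
        have h2 := int_sq_le k
        have h3 : ((k.natAbs : ℕ):ℝ) = |(k:ℝ)| := by
          rw [Nat.cast_natAbs]; simp
        rw [h3]
        have h4 : |(k:ℝ)| * (1/2) ≤ (k:ℝ)^2 * z.re := mul_le_mul h2 hz.le (by norm_num) (by positivity)
        nlinarith [Real.pi_pos, mul_le_mul_of_nonneg_left h4 Real.pi_pos.le]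
      refine h1.trans ?_
      rw [Real.exp_nat_mul]
      exact pow_le_pow_left₀ (Real.exp_pos _).le hq _
  have he : cT 0 z = 1 + ∑' k : ℤ, (if k = 0 then (0:ℂ) else Complex.exp ((-π * ((k : ℝ) - (0:ℝ)) ^ 2 : ℝ) * z)) := by
    unfold cT
    rw [hs.tsum_eq_add_tsum_ite 0]
    simp
  rw [he]
  have := norm_sub_le_norm_add (1:ℂ) (∑' k : ℤ, (if k = 0 then (0:ℂ) else Complex.exp ((-π * ((k : ℝ) - (0:ℝ)) ^ 2 : ℝ) * z)))
  rw [norm_one] at this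
  linarith

noncomputable def SS : ℝ := ∑' k : ℤ, Real.exp (-π * (k:ℝ) ^ 2 / 8)

lemma SS_pos : 0 < SS := summ_u.tsum_pos (fun _ => (Real.exp_pos _).le) 0 (Real.exp_pos _)

lemma cT_upper (ξ : ℝ) (h : |ξ| ≤ 1/2) (t : ℝ) (ht : 1 < t) (z : ℂ) (hz : 3 * t / 4 ≤ z.re) :
    ‖cT ξ z‖ ≤ SS * Real.exp (-π * t * ξ^2/5) := by
  refine tsum_of_norm_bounded (summ_u.hasSum.mul_right _) (fun k => ?_)
  rw [term_norm, ← Real.exp_add]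
  apply Real.exp_le_exp.2
  have h1 := sq_shift1 k ξ h
  have h2 := sq_shift2 k ξ h
  have h3 : ((k:ℝ)-ξ)^2 * (3*t/4) ≤ ((k:ℝ)-ξ)^2 * z.re := mul_le_mul_of_nonneg_left hz (by positivity)
  have h4 : t * ξ^2 ≤ t * ((k:ℝ)-ξ)^2 := mul_le_mul_of_nonneg_left h1 (by linarith)
  have h5 : (k:ℝ)^2/4 ≤ t * ((k:ℝ)-ξ)^2 := by nlinarith [sq_nonneg ((k:ℝ)-ξ)]
  have h7 : 0 ≤ t * ξ^2 := by positivity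
  have h6 : t * ξ^2/5 + (k:ℝ)^2/8 ≤ ((k:ℝ)-ξ)^2 * z.re := by nlinarith
  nlinarith [Real.pi_pos, mul_le_mul_of_nonneg_left h6 Real.pi_pos.le]

lemma exp_diff (u : ℂ) : ‖Complex.exp u - Complex.exp (-u)‖ ≤ 2 * ‖u‖ * Real.exp ‖u‖ := by
  have h1 := Complex.norm_exp_sub_sum_le_norm_mul_exp u 1
  have h2 := Complex.norm_exp_sub_sum_le_norm_mul_exp (-u) 1
  simp at h1 h2
  have : Complex.exp u - Complex.exp (-u) = (Complex.exp u - 1) - (Complex.exp (-u) - 1) := by ring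
  rw [this]
  refine (norm_sub_le _ _).trans ?_
  linarith

lemma pair_bound (k : ℤ) (ξ : ℝ) (h : |ξ| ≤ 1/8) (t : ℝ) (ht : 1 < t) (z : ℂ)
    (hz : 3 * t / 4 ≤ z.re) (hz2 : ‖z‖ ≤ 5 * t / 4) :
    ‖Complex.exp ((-π * ((k : ℝ) - ξ) ^ 2 : ℝ) * z) + Complex.exp ((-π * (((-k : ℤ) : ℝ) - ξ) ^ 2 : ℝ) * z)
      - 2 * (Complex.exp ((-π * ξ^2 : ℝ) * z) * Complex.exp ((-π * (k:ℝ) ^ 2 : ℝ) * z))‖ ≤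
    Real.exp (-π * (k:ℝ) ^ 2 / 8) * (4096 * ξ^2 * Real.exp (-π * t / 4) * Real.exp (-π * t * ξ^2/5)) := by
  rcases eq_or_ne k 0 with hk | hk
  · subst hk
    have : ∀ a : ℂ, a + a - 2 * a = 0 := fun a => by ring
    simp [this]
    positivity
  set u : ℂ := (π * k * ξ : ℝ) * z with hu
  have e1 : Complex.exp ((-π * ((k : ℝ) - ξ) ^ 2 : ℝ) * z) + Complex.exp ((-π * (((-k : ℤ) : ℝ) - ξ) ^ 2 : ℝ) * z)
      - 2 * (Complex.exp ((-π * ξ^2 : ℝ) * z) * Complex.exp ((-π * (k:ℝ) ^ 2 : ℝ) * z))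
      = Complex.exp ((-π * ξ^2 : ℝ) * z) * Complex.exp ((-π * (k:ℝ) ^ 2 : ℝ) * z) *
        (Complex.exp u - Complex.exp (-u))^2 := by
    have a1 : ((-π * ((k : ℝ) - ξ) ^ 2 : ℝ) * z) = ((-π * ξ^2 : ℝ) * z) + ((-π * (k:ℝ) ^ 2 : ℝ) * z) + (u + u) := by
      rw [hu]; push_cast; ring
    have a2 : ((-π * (((-k : ℤ) : ℝ) - ξ) ^ 2 : ℝ) * z) = ((-π * ξ^2 : ℝ) * z) + ((-π * (k:ℝ) ^ 2 : ℝ) * z) + (-u + -u) := by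
      rw [hu]; push_cast; ring
    have a3 : Complex.exp u * Complex.exp (-u) = 1 := by rw [← Complex.exp_add]; simp
    rw [a1, a2]
    simp only [Complex.exp_add]
    linear_combination (2 * Complex.exp ((-π * ξ^2 : ℝ) * z) * Complex.exp ((-π * (k:ℝ) ^ 2 : ℝ) * z)) * a3
  rw [e1, norm_mul, norm_mul, norm_pow, term_norm, term_norm]
  have hk1 : (1:ℝ) ≤ (k:ℝ)^2 := by
    have h1 : (1:ℝ) ≤ |(k:ℝ)| := by exact_mod_cast Int.one_le_abs hk
    linarith [int_sq_le k]
  have hpi := Real.pi_pos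
  set b : ℝ := π * ((k:ℝ)^2 * t) with hb
  have hb0 : 0 ≤ b := by positivity
  have hun : ‖u‖ = π * |(k:ℝ)| * |ξ| * ‖z‖ := by
    rw [hu, norm_mul, Complex.norm_real, Real.norm_eq_abs, abs_mul, abs_mul, abs_of_pos hpi]
  have hu1 : ‖u‖ ≤ |ξ| * (5/4) * b := by
    rw [hun, hb]
    have : |(k:ℝ)| * ‖z‖ ≤ (k:ℝ)^2 * (5*t/4) := mul_le_mul (int_sq_le k) hz2 (norm_nonneg _) (by positivity)
    have := mul_le_mul_of_nonneg_left this (show 0 ≤ π * |ξ| by positivity)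
    linarith
  have hu2 : ‖u‖ ≤ 5/32 * b := by
    have := mul_le_mul_of_nonneg_right h hb0
    linarith
  have hu3 : ‖u‖^2 ≤ 2 * ξ^2 * b^2 := by
    have := pow_le_pow_left₀ (norm_nonneg u) hu1 2
    rw [← sq_abs ξ]
    have h9 : 0 ≤ |ξ|^2 * b^2 := by positivity
    nlinarith
  have hbb : b^2 ≤ 512 * Real.exp (b/16) := by
    have := Real.pow_div_factorial_le_exp (b/16) (by positivity) 2
    norm_num at this
    linarith
  have hd : ‖Complex.exp u - Complex.exp (-u)‖^2 ≤ 4096 * ξ^2 * Real.exp (b/16 + 5/16 * b) := by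
    have h1 := pow_le_pow_left₀ (norm_nonneg _) (exp_diff u) 2
    have h2 : Real.exp ‖u‖ ^ 2 ≤ Real.exp (5/16*b) := by
      rw [← Real.exp_nat_mul]; apply Real.exp_le_exp.2; push_cast; linarith
    calc _ ≤ _ := h1
      _ = 4 * (‖u‖^2 * Real.exp ‖u‖^2) := by ring
      _ ≤ 4 * ((2 * ξ^2 * (512 * Real.exp (b/16))) * Real.exp (5/16*b)) := by
        gcongr
        exact hu3.trans (by gcongr)
      _ = _ := by rw [Real.exp_add]; ring
  calc _ ≤ Real.exp (-π * ξ^2 * z.re) * Real.exp (-π * (k:ℝ)^2 * z.re) * (4096 * ξ^2 * Real.exp (b/16 + 5/16 * b)) := by gcongr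
    _ = 4096 * ξ^2 * Real.exp (-π * ξ^2 * z.re + -π * (k:ℝ)^2 * z.re + (b/16 + 5/16 * b)) := by
      rw [Real.exp_add (_ + _) (_ + _), Real.exp_add (-π * ξ^2 * z.re)]; ring
    _ ≤ 4096 * ξ^2 * Real.exp (-π * (k:ℝ) ^ 2 / 8 + (-π * t / 4) + (-π * t * ξ^2/5)) := by
      refine mul_le_mul_of_nonneg_left (Real.exp_le_exp.2 ?_) (by positivity)
      have h1 : π * ξ^2 * (3*t/4) ≤ π * ξ^2 * z.re := by gcongr
      have h2 : π * (k:ℝ)^2 * (3*t/4) ≤ π * (k:ℝ)^2 * z.re := by gcongr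
      have h3 : π * (k:ℝ)^2 * 1 ≤ π * (k:ℝ)^2 * t := by gcongr
      have h4 : π * t * 1 ≤ π * t * (k:ℝ)^2 := by gcongr
      have h5 : 0 ≤ π * ξ^2 * t := by positivity
      rw [hb]
      nlinarith
    _ = _ := by rw [Real.exp_add, Real.exp_add]; ring

lemma num_bound (ξ : ℝ) (h : |ξ| ≤ 1/8) (t : ℝ) (ht : 1 < t) (z : ℂ)
    (hz : 3 * t / 4 ≤ z.re) (hz2 : ‖z‖ ≤ 5 * t / 4) :
    ‖cT ξ z - Complex.exp ((-π * ξ^2 : ℝ) * z) * cT 0 z‖ ≤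
      SS * (4096 * ξ^2 * Real.exp (-π * t / 4) * Real.exp (-π * t * ξ^2/5)) := by
  have hz' : 1/2 < z.re := by linarith
  have s1 := cT_summable ξ (by linarith) z hz'
  have s2 := cT_summable 0 (by norm_num) z hz'
  have s3 : Summable (fun k : ℤ => Complex.exp ((-π * (((-k : ℤ) : ℝ) - ξ) ^ 2 : ℝ) * z)) :=
    (Equiv.neg ℤ).summable_iff.2 s1
  have e3 : ∑' k : ℤ, Complex.exp ((-π * (((-k : ℤ) : ℝ) - ξ) ^ 2 : ℝ) * z) = cT ξ z :=
    (Equiv.neg ℤ).tsum_eq (fun k : ℤ => Complex.exp ((-π * ((k : ℝ) - ξ) ^ 2 : ℝ) * z))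
  simp only [sub_zero] at s2
  have e2 : cT 0 z = ∑' k : ℤ, Complex.exp ((-π * (k:ℝ) ^ 2 : ℝ) * z) := by
    unfold cT; simp only [sub_zero]
  have hb := tsum_of_norm_bounded (summ_u.hasSum.mul_right
    (4096 * ξ^2 * Real.exp (-π * t / 4) * Real.exp (-π * t * ξ^2/5)))
    (fun k => pair_bound k ξ h t ht z hz hz2)
  rw [Summable.tsum_sub (s1.add s3) ((s2.mul_left _).mul_left 2), Summable.tsum_add s1 s3, tsum_mul_left,
    tsum_mul_left, e3, ← e2] at hb
  change ‖cT ξ z + cT ξ z - _‖ ≤ _ at hb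
  have e4 : cT ξ z + cT ξ z - 2 * (Complex.exp ((-π * ξ^2 : ℝ) * z) * cT 0 z) =
    2 * (cT ξ z - Complex.exp ((-π * ξ^2 : ℝ) * z) * cT 0 z) := by ring
  rw [e4, norm_mul] at hb
  have := norm_nonneg (cT ξ z - Complex.exp ((-π * ξ^2 : ℝ) * z) * cT 0 z)
  change _ ≤ SS * _ at hb
  have e5 : ‖(2:ℂ)‖ = 2 := by norm_num
  rw [e5] at hb
  linarith

lemma iter_re (F : ℂ → ℂ) (hF : DifferentiableOn ℂ F {z : ℂ | 1/2 < z.re}) (n : ℕ) :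
    DifferentiableOn ℂ (iteratedDeriv n F) {z : ℂ | 1/2 < z.re} := by
  induction n with
  | zero => simpa using hF
  | succ n ih => rw [iteratedDeriv_succ]; exact ih.deriv U_open

lemma iter_real (F : ℂ → ℂ) (hF : DifferentiableOn ℂ F {z : ℂ | 1/2 < z.re}) (f : ℝ → ℝ)
    (hf : ∀ s : ℝ, f s = (F s).re) (n : ℕ) :
    ∀ s : ℝ, 1/2 < s → iteratedDeriv n f s = (iteratedDeriv n F s).re := by
  induction n with
  | zero => intro s _; simp [hf]
  | succ n ih =>
    intro s hs
    rw [iteratedDeriv_succ, iteratedDeriv_succ]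
    have h1 : iteratedDeriv n f =ᶠ[nhds s] fun x : ℝ => (iteratedDeriv n F x).re := by
      filter_upwards [Ioi_mem_nhds hs] with x hx using ih x hx
    rw [h1.deriv_eq]
    have h2 : DifferentiableAt ℂ (iteratedDeriv n F) (s:ℂ) :=
      (iter_re F hF n).differentiableAt (U_open.mem_nhds (by simpa using hs))
    exact h2.hasDerivAt.real_of_complex.deriv

lemma ball_facts (t : ℝ) (ht : 1 < t) (z : ℂ) (hz : z ∈ Metric.closedBall (t:ℂ) (1/4)) :
    3 * t / 4 ≤ z.re ∧ ‖z‖ ≤ 5 * t / 4 := by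
  rw [Metric.mem_closedBall, dist_eq_norm] at hz
  constructor
  · have h1 := (Complex.abs_re_le_norm (z - t)).trans hz
    rw [abs_le] at h1
    simp at h1
    linarith [h1.1]
  · have h1 := norm_add_le (z - t) (t:ℂ)
    rw [sub_add_cancel, Complex.norm_real, Real.norm_eq_abs, abs_of_pos (by linarith)] at h1
    linarith

lemma cauchy (F : ℂ → ℂ) (hF : DifferentiableOn ℂ F {z : ℂ | 1/2 < z.re}) (n : ℕ) (t : ℝ) (ht : 1 < t)
    (B : ℝ) (hB : ∀ z ∈ Metric.closedBall (t:ℂ) (1/4), ‖F z‖ ≤ B) :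
    ‖iteratedDeriv n F t‖ ≤ n.factorial * 4^n * B := by
  have h1 : DiffContOnCl ℂ F (Metric.ball (t:ℂ) (1/4)) := by
    apply DifferentiableOn.diffContOnCl
    apply hF.mono
    intro z hz
    have := (ball_facts t ht z (Metric.closure_ball_subset_closedBall hz)).1
    simp only [Set.mem_ofPred_eq]
    linarith
  have := Complex.norm_iteratedDeriv_le_of_forall_mem_sphere_norm_le n (by norm_num) h1
    (fun z hz => hB z (Metric.sphere_subset_closedBall hz))
  refine this.trans (le_of_eq ?_)
  rw [one_div, inv_pow, div_inv_eq_mul]; ring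

/-- Derivative bounds for the ratio `θ_t(ξ)/θ_t(0)` at large scales: for each `n ∈ ℕ` there is
`C_n > 0` such that for all `t > 1` and `ξ ∈ 𝕋`,
`|t^n ∂_t^n (θ_t(ξ)/θ_t(0))| ≤ C_n (t^n ξ^{2n} + ξ² e^{-πt/5}) exp(-πtξ²/5)`. -/
theorem theta_ratio_deriv_large_scales (n : ℕ) :
    ∃ C : ℝ, 0 < C ∧ ∀ t : ℝ, 1 < t → ∀ ξ : ℝ, ξ ∈ Set.Ico (-(1/2) : ℝ) (1/2) →
      |t ^ n * iteratedDeriv n (fun s => theta s ξ / theta s 0) t| ≤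
        C * (t ^ n * ξ ^ (2 * n) + ξ ^ 2 * Real.exp (-π * t / 5)) *
          Real.exp (-π * t * ξ ^ 2 / 5) := by
  have hpi := Real.pi_pos
  have hS := SS_pos
  set A : ℝ := n.factorial * 4^n * (SS * 3) with hA
  set M : ℝ := n.factorial * (20/π)^n with hM
  have hA0 : 0 < A := by positivity
  have hM0 : 0 < M := by positivity
  refine ⟨A * 64^n + π^n + A * 4096 * M, by positivity, ?_⟩
  intro t ht ξ hξ
  have ht0 : 0 < t := by linarith
  have hx : |ξ| ≤ 1/2 := abs_le.2 ⟨hξ.1, hξ.2.le⟩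
  set F : ℂ → ℂ := fun z => cT ξ z / cT 0 z with hFdef
  have hne : ∀ z : ℂ, 1/2 < z.re → cT 0 z ≠ 0 := by
    intro z hz h0
    have := cT_zero_lower z hz
    rw [h0, norm_zero] at this
    linarith
  have hF : DifferentiableOn ℂ F {z : ℂ | 1/2 < z.re} :=
    (cT_diff ξ hx).div (cT_diff 0 (by norm_num)) hne
  have hre : iteratedDeriv n (fun s => theta s ξ / theta s 0) t = (iteratedDeriv n F t).re := by
    refine iter_real F hF _ (fun s => ?_) n t (by linarith)
    simp only [hFdef, cT_real]
    rw [← Complex.ofReal_div, Complex.ofReal_re]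
  have hle : |t ^ n * iteratedDeriv n (fun s => theta s ξ / theta s 0) t| ≤ t^n * ‖iteratedDeriv n F t‖ := by
    rw [abs_mul, abs_of_pos (by positivity : 0 < t^n), hre]
    gcongr
    exact Complex.abs_re_le_norm _
  refine hle.trans ?_
  set e := Real.exp (-π * t * ξ ^ 2 / 5) with he
  have he0 : 0 < e := Real.exp_pos _
  have hdiv : ∀ (w z : ℂ), 1/2 < z.re → ‖w / cT 0 z‖ ≤ 3 * ‖w‖ := by
    intro w z hz
    have h1 := cT_zero_lower z hz
    rw [norm_div, div_le_iff₀ (by linarith)]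
    nlinarith [norm_nonneg w]
  have hx2n : 0 ≤ ξ^(2*n) := by rw [pow_mul]; positivity
  rcases le_or_gt |ξ| (1/8) with h8 | h8
  · set G : ℂ → ℂ := fun z => Complex.exp ((-π * ξ^2 : ℝ) * z) with hG
    set P : ℂ → ℂ := fun z => (cT ξ z - Complex.exp ((-π * ξ^2 : ℝ) * z) * cT 0 z) / cT 0 z with hP
    have hGd : DifferentiableOn ℂ G {z : ℂ | 1/2 < z.re} := by
      simp only [hG]; fun_prop
    have hPd : DifferentiableOn ℂ P {z : ℂ | 1/2 < z.re} :=
      ((cT_diff ξ hx).sub (hGd.mul (cT_diff 0 (by norm_num)))).div (cT_diff 0 (by norm_num)) hne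
    have hmem : {z : ℂ | 1/2 < z.re} ∈ nhds (t:ℂ) := U_open.mem_nhds (by simp; linarith)
    have hsum : iteratedDeriv n F t = iteratedDeriv n G t + iteratedDeriv n P t := by
      rw [← iteratedDeriv_fun_add ((hGd.contDiffOn U_open).contDiffAt hmem)
        ((hPd.contDiffOn U_open).contDiffAt hmem)]
      apply Filter.EventuallyEq.iteratedDeriv_eq
      filter_upwards [hmem] with z hz
      have := hne z hz
      simp only [hFdef, hG, hP]
      field_simp
      ring
    have hGn : ‖iteratedDeriv n G t‖ ≤ π^n * ξ^(2*n) * e := by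
      simp only [hG]
      rw [iteratedDeriv_cexp_const_mul]
      rw [norm_mul, norm_pow, term_norm, Complex.norm_real, Real.norm_eq_abs, neg_mul, abs_neg,
        abs_of_nonneg (by positivity), mul_pow, ← pow_mul, Complex.ofReal_re]
      refine mul_le_mul_of_nonneg_left (Real.exp_le_exp.2 ?_) (by positivity)
      have : 0 ≤ π * t * ξ^2 := by positivity
      linarith
    have hPn : ‖iteratedDeriv n P t‖ ≤ A * 4096 * ξ^2 * Real.exp (-π * t / 4) * e := by
      have := cauchy P hPd n t ht (3 * (SS * (4096 * ξ^2 * Real.exp (-π * t / 4) * e))) (by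
        intro z hz
        obtain ⟨h1, h2⟩ := ball_facts t ht z hz
        refine (hdiv _ z (by linarith)).trans ?_
        gcongr
        exact num_bound ξ h8 t ht z h1 h2)
      refine this.trans (le_of_eq ?_)
      rw [hA]; ring
    have htn : t^n * Real.exp (-π * t / 4) ≤ M * Real.exp (-π * t / 5) := by
      have h1 := Real.pow_div_factorial_le_exp (π * t / 20) (by positivity) n
      rw [div_le_iff₀ (by positivity)] at h1
      have h2 : t^n ≤ M * Real.exp (π * t / 20) := by
        have h3 : t^n = (20/π)^n * (π * t / 20)^n := by
          rw [← mul_pow]; congr 1; field_simp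
        rw [h3, hM]
        calc _ ≤ (20/π)^n * (Real.exp (π * t / 20) * n.factorial) := by gcongr
          _ = _ := by ring
      calc _ ≤ M * Real.exp (π * t / 20) * Real.exp (-π * t / 4) := by gcongr
        _ = _ := by rw [mul_assoc, ← Real.exp_add]; congr 2; ring
    rw [hsum]
    set q := Real.exp (-π * t / 5) with hq
    have hq0 : 0 < q := Real.exp_pos _
    calc t^n * ‖iteratedDeriv n G t + iteratedDeriv n P t‖
        ≤ t^n * (π^n * ξ^(2*n) * e + A * 4096 * ξ^2 * Real.exp (-π * t / 4) * e) := by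
          gcongr
          exact (norm_add_le _ _).trans (add_le_add hGn hPn)
      _ = π^n * (t^n * ξ^(2*n)) * e + A * 4096 * ξ^2 * e * (t^n * Real.exp (-π * t / 4)) := by ring
      _ ≤ π^n * (t^n * ξ^(2*n)) * e + A * 4096 * ξ^2 * e * (M * q) := by gcongr
      _ ≤ _ := by
        have i1 : 0 ≤ (A * 64^n + A * 4096 * M) * (t^n * ξ^(2*n)) * e := by positivity
        have i2 : 0 ≤ (A * 64^n + π^n) * (ξ^2 * q) * e := by positivity
        nlinarith
  · have hFn : ‖iteratedDeriv n F t‖ ≤ A * e := by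
      have := cauchy F hF n t ht (3 * (SS * e)) (by
        intro z hz
        obtain ⟨h1, h2⟩ := ball_facts t ht z hz
        refine (hdiv _ z (by linarith)).trans ?_
        gcongr
        exact cT_upper ξ hx t ht z h1)
      refine this.trans (le_of_eq ?_)
      rw [hA]; ring
    have h64 : 1 ≤ 64^n * ξ^(2*n) := by
      rw [pow_mul, ← mul_pow]
      apply one_le_pow₀
      rw [← sq_abs]; nlinarith
    calc t^n * ‖iteratedDeriv n F t‖ ≤ t^n * (A * e) * 1 := by rw [mul_one]; gcongr
      _ ≤ t^n * (A * e) * (64^n * ξ^(2*n)) := by gcongr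
      _ ≤ _ := by
        have i1 : 0 ≤ (π^n + A * 4096 * M) * (t^n * ξ^(2*n)) * e := by positivity
        have i2 : 0 ≤ (A * 64^n + π^n + A * 4096 * M) * (ξ^2 * Real.exp (-π * t / 5)) * e := by positivity
        nlinarith
end

section
/- For each n ∈ ℕ there exists a constant C_n > 0, independent of the dimension d ∈ ℤ_+, such that for all d ∈ ℤ_+, all t ≥ 15 and all ξ ∈ 𝕋^d one has | t^n ∂_t^n F_{ℤ^d} g_t(ξ) | ≤ C_n exp( -πt|ξ|² 2^{-n} / 10 ), where ∂_t^n denotes the n-th derivative in t of the smooth function t ↦ F_{ℤ^d} g_t(ξ) = Θ_t(ξ)/Θ_t(0) on (0,∞). -/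
open scoped ENNReal Real BigOperators
open Real

namespace FG

lemma int_sum_bound {f : ℤ → ℂ} {a : ℂ} {c M : ℝ} (hf : HasSum f a) (h0 : ‖f 0‖ ≤ c)
    (h : ∀ k : ℤ, k ≠ 0 → ‖f k‖ ≤ M * (1 / 10 : ℝ) ^ (k.natAbs - 1)) :
    ‖a‖ ≤ c + 20 / 9 * M := by
  let g : ℤ → ℝ := fun k => if k = 0 then c else M * (1 / 10 : ℝ) ^ (k.natAbs - 1)
  have hgeo : HasSum (fun n : ℕ => M * (1 / 10 : ℝ) ^ n) (M * (1 - 1 / 10)⁻¹) :=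
    (hasSum_geometric_of_lt_one (by norm_num) (by norm_num)).mul_left M
  have hg : HasSum g (M * (1 - 1 / 10)⁻¹ + g 0 + M * (1 - 1 / 10)⁻¹) := by
    apply HasSum.of_add_one_of_neg_add_one
    · refine hgeo.congr_fun ?_ |> fun h => h
      intro n
      have h1 : ((n : ℤ) + 1) ≠ 0 := by omega
      have h2 : ((n : ℤ) + 1).natAbs - 1 = n := by omega
      simp only [g, h1, h2, if_false]
    · refine hgeo.congr_fun ?_ |> fun h => h
      intro n
      have h1 : (-((n : ℤ) + 1)) ≠ 0 := by omega
      have h2 : (-((n : ℤ) + 1)).natAbs - 1 = n := by omega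
      simp only [g, h1, h2, if_false]
  have := hf.norm_le_of_bounded hg (fun k => by
    by_cases hk : k = 0
    · subst hk; simpa [g] using h0
    · simpa only [g, hk, if_false] using h k hk)
  refine this.trans (le_of_eq ?_)
  simp only [g, if_true]
  ring

lemma exp_neg_le {b : ℝ} (m : ℕ) (hb : (m : ℝ) ≤ b) : Real.exp (-b) ≤ (1 / 2) ^ m := by
  have h1 : Real.exp (-1) ≤ 1 / 2 := by
    rw [Real.exp_neg, one_div]
    apply inv_anti₀ (by norm_num)
    have := Real.add_one_le_exp (1 : ℝ)
    linarith
  calc Real.exp (-b) ≤ Real.exp (m * (-1)) := Real.exp_le_exp.mpr (by linarith)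
    _ = Real.exp (-1) ^ m := Real.exp_nat_mul _ _
    _ ≤ _ := pow_le_pow_left₀ (Real.exp_pos _).le h1 m

lemma exp_geo {b : ℝ} (hb : 4 ≤ b) (j : ℕ) : Real.exp (-b * j) ≤ (1 / 10) ^ j := by
  have h1 : Real.exp (-b) ≤ 1 / 10 := (exp_neg_le 4 (by exact_mod_cast hb)).trans (by norm_num)
  rw [mul_comm, Real.exp_nat_mul]
  exact pow_le_pow_left₀ (Real.exp_pos _).le h1 j

lemma exp_sq {b : ℝ} (hb : 4 ≤ b) {k : ℤ} (hk : k ≠ 0) :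
    Real.exp (-b * (k : ℝ) ^ 2) ≤ Real.exp (-b) * (1 / 10) ^ (k.natAbs - 1) := by
  obtain ⟨j, hj⟩ : ∃ j : ℕ, k.natAbs = j + 1 := ⟨k.natAbs - 1, by omega⟩
  have hk2 : (k : ℝ) ^ 2 = ((j : ℝ) + 1) ^ 2 := by
    have : (k.natAbs : ℤ) ^ 2 = k ^ 2 := Int.natAbs_sq k
    rw [hj] at this
    have h' : (((j + 1 : ℕ) : ℤ) : ℝ) ^ 2 = (k : ℝ) ^ 2 := by exact_mod_cast this
    rw [← h']; push_cast; ring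
  have : k.natAbs - 1 = j := by omega
  rw [this, hk2]
  calc Real.exp (-b * ((j : ℝ) + 1) ^ 2) ≤ Real.exp (-b + -b * j) := by
        apply Real.exp_le_exp.mpr
        have : (0 : ℝ) ≤ j := j.cast_nonneg
        nlinarith [mul_nonneg (show (0:ℝ) ≤ b by linarith) this, mul_nonneg (mul_nonneg (show (0:ℝ) ≤ b by linarith) this) this]
    _ = Real.exp (-b) * Real.exp (-b * j) := Real.exp_add _ _
    _ ≤ _ := by gcongr; exact exp_geo hb j

lemma abs_int_ge {k : ℤ} (hk : k ≠ 0) : (1 : ℝ) ≤ |(k : ℝ)| := by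
  have := Int.one_le_abs hk
  exact_mod_cast this

/-- `ψ(z, ζ)` -/
noncomputable def psi (z : ℂ) (ζ : ℝ) : ℂ := jacobiTheta₂ (-Complex.I * ζ * z) (Complex.I * z)

noncomputable def term (k : ℤ) (z : ℂ) (ζ : ℝ) : ℂ :=
  jacobiTheta₂_term k (-Complex.I * ζ * z) (Complex.I * z)

lemma term_eq (k : ℤ) (z : ℂ) (ζ : ℝ) :
    term k z ζ = Complex.exp (-π * k ^ 2 * z + 2 * π * k * ζ * z) := by
  rw [term, jacobiTheta₂_term]
  congr 1
  linear_combination (-2 * π * k * ζ * z + π * k ^ 2 * z) * Complex.I_sq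

lemma hasSum_psi {z : ℂ} (hz : 0 < z.re) (ζ : ℝ) :
    HasSum (fun k => term k z ζ) (psi z ζ) :=
  hasSum_jacobiTheta₂_term _ (by simpa using hz)

lemma norm_term (k : ℤ) (z : ℂ) (ζ : ℝ) :
    ‖term k z ζ‖ = Real.exp (-(π * z.re) * k ^ 2 + 2 * (π * z.re) * (k * ζ)) := by
  rw [term_eq, Complex.norm_exp]
  congr 1
  have : (-π * k ^ 2 * z + 2 * π * k * ζ * z : ℂ)
    = ((-π * k ^ 2 + 2 * π * k * ζ : ℝ) : ℂ) * z := by push_cast; ring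
  rw [this, Complex.re_ofReal_mul]
  ring

lemma psi_zero_bound {z : ℂ} (hz : 46 ≤ π * z.re) : ‖psi z 0 - 1‖ ≤ 1 / 100 := by
  have hre : 0 < z.re := by
    by_contra h
    push Not at h
    nlinarith [Real.pi_pos]
  have h1 : HasSum (fun k : ℤ => term k z 0 - if k = 0 then 1 else 0) (psi z 0 - 1) :=
    (hasSum_psi hre 0).sub (hasSum_ite_eq 0 1)
  have h2 := int_sum_bound (c := 0) (M := Real.exp (-(π * z.re))) h1 (by simp [term_eq]) (by
    intro k hk
    simp only [hk, if_false, sub_zero, norm_term, mul_zero, add_zero]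
    exact exp_sq (by linarith) hk)
  have h3 := exp_neg_le (b := π * z.re) 10 (by norm_num; linarith)
  norm_num at h3
  linarith

lemma large {z : ℂ} (hz : 46 ≤ π * z.re) {ζ : ℝ} (hζ : |ζ| ≤ 1 / 2) : ‖psi z ζ‖ ≤ 29 / 9 := by
  have hre : 0 < z.re := by
    by_contra h
    push Not at h
    nlinarith [Real.pi_pos]
  have h2 := int_sum_bound (c := 1) (M := 1) (hasSum_psi hre ζ) (by simp [term_eq]) (by
    intro k hk
    rw [norm_term, one_mul]
    refine le_trans (Real.exp_le_exp.mpr ?_) (exp_geo (b := π * z.re) (by linarith) _)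
    have e1 : ((k.natAbs - 1 : ℕ) : ℝ) = |(k : ℝ)| - 1 := by
      rw [Nat.cast_sub (by omega), Nat.cast_natAbs]; simp
    rw [e1]
    have e2 := abs_int_ge hk
    have e3 : (k : ℝ) * ζ ≤ |(k : ℝ)| * (1 / 2) := by
      refine (le_abs_self _).trans ?_
      rw [abs_mul]; gcongr
    rw [← sq_abs (k : ℝ)]
    have e4 : 2 * (k * ζ) - |(k : ℝ)| ^ 2 + (|(k : ℝ)| - 1) ≤ 0 := by nlinarith
    nlinarith [mul_nonneg_of_nonpos_of_nonpos e4 (show -(π * z.re) ≤ 0 by linarith)])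
  linarith

lemma cexp_bound (a : ℂ) : ‖Complex.exp a - 1 - a‖ ≤ ‖a‖ ^ 2 * Real.exp ‖a‖ := by
  have := Complex.norm_exp_sub_sum_le_norm_mul_exp a 2
  simp only [Finset.sum_range_succ, Finset.sum_range_zero] at this
  simpa [sub_sub] using this

lemma small {z : ℂ} {s : ℝ} (hs : 47 ≤ s) (hz : 99 / 100 * s ≤ π * z.re)
    (hz' : π * ‖z‖ ≤ 101 / 100 * s) {ζ : ℝ} (hζ : |ζ| ≤ 3 / 10) :
    ‖psi z ζ - psi z 0‖ ≤ ζ ^ 2 * s / 10 := by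
  have hre : 0 < z.re := by
    by_contra h
    push Not at h
    nlinarith [Real.pi_pos]
  have h1 : HasSum (fun k : ℤ => term k z ζ - term k z 0) (psi z ζ - psi z 0) :=
    (hasSum_psi hre ζ).sub (hasSum_psi hre 0)
  have h2 : HasSum (fun k : ℤ => term (-k) z ζ - term (-k) z 0) (psi z ζ - psi z 0) :=
    (Equiv.neg ℤ).hasSum_iff.mpr h1
  set B : ℝ := 384 / 1000 * s - 1 with hB
  have h3 := int_sum_bound (c := 0) (M := 2 * (5 * ζ ^ 2 * s ^ 2 * Real.exp (-B))) (h1.add h2)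
    (by simp [term_eq]) (by
    intro k hk
    set a : ℂ := 2 * π * k * ζ * z with ha
    have e1 : term k z ζ - term k z 0 + (term (-k) z ζ - term (-k) z 0)
        = term k z 0 * (Complex.exp a - 1 - a) + term k z 0 * (Complex.exp (-a) - 1 - (-a)) := by
      have t1 : term k z ζ = term k z 0 * Complex.exp a := by
        rw [term_eq, term_eq, ← Complex.exp_add]; congr 1; simp [ha]
      have t2 : term (-k) z ζ = term k z 0 * Complex.exp (-a) := by
        rw [term_eq, term_eq, ← Complex.exp_add]; congr 1; simp [ha]
      have t3 : term (-k) z 0 = term k z 0 := by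
        rw [term_eq, term_eq]; congr 1; simp
      rw [t1, t2, t3]; ring
    have hna : ‖a‖ = 2 * |(k : ℝ)| * |ζ| * (π * ‖z‖) := by
      simp [ha, abs_of_pos Real.pi_pos]; ring
    have hk1 := abs_int_ge hk
    have hna1 : ‖a‖ ≤ 2 * |(k : ℝ)| * |ζ| * (101 / 100 * s) := by
      rw [hna]; gcongr
    have hna2 : ‖a‖ ≤ 606 / 1000 * s * (k : ℝ) ^ 2 := by
      calc ‖a‖ ≤ 2 * |(k : ℝ)| * |ζ| * (101 / 100 * s) := hna1
        _ ≤ 2 * |(k : ℝ)| * (3 / 10) * (101 / 100 * s) := by gcongr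
        _ = 606 / 1000 * s * |(k : ℝ)| := by ring
        _ ≤ 606 / 1000 * s * |(k : ℝ)| ^ 2 := by
          gcongr; nlinarith
        _ = _ := by rw [sq_abs]
    have hna3 : ‖a‖ ^ 2 ≤ 5 * ζ ^ 2 * s ^ 2 * (k : ℝ) ^ 2 := by
      calc ‖a‖ ^ 2 ≤ (2 * |(k : ℝ)| * |ζ| * (101 / 100 * s)) ^ 2 := by gcongr
        _ = 4 * (101 / 100) ^ 2 * |ζ| ^ 2 * s ^ 2 * |(k : ℝ)| ^ 2 := by ring
        _ = 4 * (101 / 100) ^ 2 * (ζ ^ 2 * s ^ 2 * (k : ℝ) ^ 2) := by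
          rw [sq_abs, sq_abs]; ring
        _ ≤ 5 * (ζ ^ 2 * s ^ 2 * (k : ℝ) ^ 2) := by gcongr; norm_num
        _ = _ := by ring
    have key : ‖term k z 0‖ * (‖a‖ ^ 2 * Real.exp ‖a‖)
        ≤ 5 * ζ ^ 2 * s ^ 2 * Real.exp (-B) * (1 / 10) ^ (k.natAbs - 1) := by
      rw [norm_term, mul_zero, mul_zero, add_zero]
      calc Real.exp (-(π * z.re) * k ^ 2) * (‖a‖ ^ 2 * Real.exp ‖a‖)
          ≤ Real.exp (-(99 / 100 * s) * k ^ 2) * ((5 * ζ ^ 2 * s ^ 2 * Real.exp ((k : ℝ) ^ 2))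
              * Real.exp (606 / 1000 * s * (k : ℝ) ^ 2)) := by
            gcongr
            refine hna3.trans ?_
            gcongr
            linarith [Real.add_one_le_exp ((k : ℝ) ^ 2)]
        _ = 5 * ζ ^ 2 * s ^ 2 * Real.exp (-B * (k : ℝ) ^ 2) := by
            have : -B * (k : ℝ) ^ 2 = -(99 / 100 * s) * k ^ 2 + (k : ℝ) ^ 2
              + 606 / 1000 * s * (k : ℝ) ^ 2 := by rw [hB]; ring
            rw [this, Real.exp_add, Real.exp_add]; ring
        _ ≤ 5 * ζ ^ 2 * s ^ 2 * (Real.exp (-B) * (1 / 10) ^ (k.natAbs - 1)) := by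
            gcongr
            exact exp_sq (by rw [hB]; linarith) hk
        _ = _ := by ring
    rw [e1]
    have b1 := cexp_bound a
    have b2 := cexp_bound (-a)
    rw [norm_neg] at b2
    calc _ ≤ ‖term k z 0 * (Complex.exp a - 1 - a)‖
          + ‖term k z 0 * (Complex.exp (-a) - 1 - (-a))‖ := norm_add_le _ _
      _ ≤ ‖term k z 0‖ * (‖a‖ ^ 2 * Real.exp ‖a‖) + ‖term k z 0‖ * (‖a‖ ^ 2 * Real.exp ‖a‖) := by
        rw [norm_mul, norm_mul]; gcongr
      _ ≤ _ := by linarith)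
  have h4 : s * Real.exp (-B) ≤ 20 * (1 / 2) ^ 14 := by
    have : s ≤ 20 * Real.exp (s / 20) := by linarith [Real.add_one_le_exp (s / 20)]
    calc s * Real.exp (-B) ≤ 20 * Real.exp (s / 20) * Real.exp (-B) := by gcongr
      _ = 20 * Real.exp (-(B - s / 20)) := by
        rw [mul_assoc, ← Real.exp_add]; congr 2; ring
      _ ≤ _ := by
        gcongr; exact exp_neg_le 14 (by rw [hB]; norm_num; linarith)
  have h5 : ‖psi z ζ - psi z 0 + (psi z ζ - psi z 0)‖ = 2 * ‖psi z ζ - psi z 0‖ := by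
    rw [← two_mul, norm_mul]; simp
  rw [h5] at h3
  have h6 : 0 ≤ ζ ^ 2 * s := by positivity
  have h7 := mul_le_mul_of_nonneg_left h4 h6
  norm_num at h7
  nlinarith

lemma main1 {t : ℝ} (ht : 15 ≤ t) {z : ℂ} (hz : ‖z - t‖ < t / 100) :
    0 < z.re ∧ psi z 0 ≠ 0 ∧ ∀ ζ : ℝ, |ζ| ≤ 1 / 2 →
      ‖Complex.exp (-π * ζ ^ 2 * z) * psi z ζ / psi z 0‖ ≤ Real.exp (-π * t * ζ ^ 2 / 10) := by
  have hre0 : |z.re - t| < t / 100 := by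
    have := Complex.abs_re_le_norm (z - t)
    simp at this
    linarith
  have hre : 99 / 100 * t ≤ z.re := by
    have := (abs_lt.mp hre0).1
    linarith
  have hno : ‖z‖ ≤ 101 / 100 * t := by
    have : ‖z‖ ≤ ‖z - t‖ + ‖(t : ℂ)‖ := by simpa using norm_add_le (z - t) (t : ℂ)
    rw [Complex.norm_real, Real.norm_of_nonneg (by linarith)] at this
    linarith
  have hpi := Real.pi_gt_d2
  set s := π * t with hs
  have hs47 : 47 ≤ s := by nlinarith
  have hb : 99 / 100 * s ≤ π * z.re := by nlinarith
  have hb' : π * ‖z‖ ≤ 101 / 100 * s := by nlinarith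
  have hb46 : 46 ≤ π * z.re := by linarith
  have h0 := psi_zero_bound hb46
  have h0' : 99 / 100 ≤ ‖psi z 0‖ := by
    have := norm_sub_norm_le (1 : ℂ) (psi z 0)
    rw [norm_sub_rev] at this
    simp at this
    linarith
  have hpos : 0 < ‖psi z 0‖ := by linarith
  refine ⟨by linarith, norm_pos_iff.mp hpos, fun ζ hζ => ?_⟩
  have key : ‖psi z ζ‖ ≤ Real.exp (89 / 100 * s * ζ ^ 2) * ‖psi z 0‖ := by
    have hexp := Real.add_one_le_exp (89 / 100 * s * ζ ^ 2)
    have hn : 0 ≤ s * ζ ^ 2 := by positivity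
    rcases le_total |ζ| (3 / 10) with h | h
    · have h1 := small hs47 hb hb' h
      have h2 : ‖psi z ζ‖ ≤ ‖psi z ζ - psi z 0‖ + ‖psi z 0‖ := by
        simpa using norm_add_le (psi z ζ - psi z 0) (psi z 0)
      nlinarith
    · have h1 := large hb46 hζ
      have h2 : 9 / 100 ≤ ζ ^ 2 := by rw [← sq_abs]; nlinarith
      have h3 : 47 * (9 / 100) ≤ s * ζ ^ 2 := by nlinarith
      nlinarith
  have hn : ‖Complex.exp (-π * ζ ^ 2 * z)‖ = Real.exp (-(π * z.re) * ζ ^ 2) := by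
    rw [Complex.norm_exp]
    congr 1
    have : (-π * ζ ^ 2 * z : ℂ) = ((-π * ζ ^ 2 : ℝ) : ℂ) * z := by push_cast; ring
    rw [this, Complex.re_ofReal_mul]; ring
  rw [norm_div, norm_mul, hn, div_le_iff₀ hpos]
  calc Real.exp (-(π * z.re) * ζ ^ 2) * ‖psi z ζ‖
      ≤ Real.exp (-(99 / 100 * s) * ζ ^ 2) * (Real.exp (89 / 100 * s * ζ ^ 2) * ‖psi z 0‖) := by
        gcongr
    _ = _ := by
        rw [← mul_assoc, ← Real.exp_add]; congr 2; rw [hs]; ring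

lemma theta_eq (t ζ : ℝ) :
    (theta t ζ : ℂ) = Complex.exp (-π * ζ ^ 2 * t) * psi t ζ := by
  rw [theta, Complex.ofReal_tsum, psi, jacobiTheta₂, ← tsum_mul_left]
  congr 1
  ext k
  have := term_eq k t ζ
  rw [term] at this
  rw [this, ← Complex.exp_add, Complex.ofReal_exp]
  congr 1
  push_cast
  ring

lemma psi_diff {z : ℂ} (hz : 0 < z.re) (ζ : ℝ) : DifferentiableAt ℂ (fun z => psi z ζ) z := by
  have h1 := (hasFDerivAt_jacobiTheta₂ (-Complex.I * ζ * z) (τ := Complex.I * z)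
    (by simpa using hz)).differentiableAt
  have h2 : DifferentiableAt ℂ (fun z : ℂ => ((-Complex.I * ζ * z, Complex.I * z) : ℂ × ℂ)) z := by
    fun_prop
  exact DifferentiableAt.comp z h1 h2

lemma iter_re {U : Set ℂ} (hU : IsOpen U) {H : ℂ → ℂ} (hH : DifferentiableOn ℂ H U)
    {f : ℝ → ℝ} (hf : ∀ s : ℝ, (s : ℂ) ∈ U → f s = (H s).re) (n : ℕ) :
    ∀ s : ℝ, (s : ℂ) ∈ U → iteratedDeriv n f s = (iteratedDeriv n H s).re := by
  induction n with
  | zero => simpa using hf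
  | succ n ih =>
    intro s hs
    rw [iteratedDeriv_succ, iteratedDeriv_succ]
    have hA : AnalyticOnNhd ℂ (iteratedDeriv n H) U := by
      rw [iteratedDeriv_eq_iterate]
      exact (hH.analyticOnNhd hU).iterated_deriv n
    have h1 := ((hA s hs).differentiableAt.hasDerivAt).real_of_complex
    have h2 : iteratedDeriv n f =ᶠ[nhds s] fun x : ℝ => (iteratedDeriv n H x).re := by
      have : ∀ᶠ x : ℝ in nhds s, (x : ℂ) ∈ U :=
        Complex.continuous_ofReal.continuousAt.eventually (hU.mem_nhds hs)
      filter_upwards [this] with x hx using ih x hx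
    rw [h2.deriv_eq, h1.deriv]

end FG

/-- Derivative bounds for `F_{ℤ^d} g_t(ξ) = Θ_t(ξ)/Θ_t(0)` at large scales: for each `n ∈ ℕ`
there is `C_n > 0`, independent of the dimension `d`, such that for all `d ∈ ℤ_+`, `t ≥ 15` and
`ξ ∈ 𝕋^d`, `|t^n ∂_t^n F_{ℤ^d} g_t(ξ)| ≤ C_n exp(-πt|ξ|² 2^{-n}/10)`. -/
theorem fourier_gauss_deriv_large_scales (n : ℕ) :
    ∃ C : ℝ, 0 < C ∧ ∀ d : ℕ, 0 < d → ∀ t : ℝ, 15 ≤ t → ∀ ξ : Fin d → ℝ,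
      (∀ j, ξ j ∈ Set.Ico (-(1/2) : ℝ) (1/2)) →
      |t ^ n * iteratedDeriv n (fun s => bigTheta d s ξ / bigTheta d s 0) t| ≤
        C * Real.exp (-π * t * (∑ j, ξ j ^ 2) * (2 : ℝ)⁻¹ ^ n / 10) := by
  refine ⟨n.factorial * 200 ^ n, by positivity, fun d _ t ht ξ hξ => ?_⟩
  have hξ' : ∀ j, |ξ j| ≤ 1 / 2 := fun j => abs_le.mpr ⟨by linarith [(hξ j).1], (hξ j).2.le⟩
  let H : ℂ → ℂ := fun z => ∏ j, (Complex.exp (-π * (ξ j) ^ 2 * z) * FG.psi z (ξ j) / FG.psi z 0)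
  have hd : DifferentiableOn ℂ H (Metric.ball (t : ℂ) (t / 100)) := by
    intro z hz
    rw [Metric.mem_ball, dist_eq_norm] at hz
    obtain ⟨h1, h2, -⟩ := FG.main1 ht hz
    apply DifferentiableAt.differentiableWithinAt
    apply DifferentiableAt.fun_finsetProd
    intro j _
    have h3 := FG.psi_diff h1 (ξ j)
    have h4 := FG.psi_diff h1 0
    have h5 : DifferentiableAt ℂ (fun z : ℂ => Complex.exp (-π * (ξ j) ^ 2 * z)) z := by fun_prop
    exact (h5.mul h3).div h4 h2
  have hb : ∀ z ∈ Metric.ball (t : ℂ) (t / 100),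
      ‖H z‖ ≤ Real.exp (-π * t * (∑ j, ξ j ^ 2) / 10) := by
    intro z hz
    rw [Metric.mem_ball, dist_eq_norm] at hz
    obtain ⟨-, -, h⟩ := FG.main1 ht hz
    calc ‖H z‖ ≤ ∏ j, Real.exp (-π * t * ξ j ^ 2 / 10) := by
          rw [norm_prod]
          exact Finset.prod_le_prod (fun _ _ => norm_nonneg _) (fun j _ => h _ (hξ' j))
      _ = _ := by
          rw [← Real.exp_sum, Finset.mul_sum, Finset.sum_div]
  have hf : ∀ s : ℝ, (s : ℂ) ∈ Metric.ball (t : ℂ) (t / 100) →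
      bigTheta d s ξ / bigTheta d s 0 = (H s).re := by
    intro s _
    have : H s = ((bigTheta d s ξ / bigTheta d s 0 : ℝ) : ℂ) := by
      simp only [H, bigTheta]
      rw [← Finset.prod_div_distrib]
      push_cast
      refine Finset.prod_congr rfl fun j _ => ?_
      rw [FG.theta_eq, FG.theta_eq]
      simp
    rw [this, Complex.ofReal_re]
  have hcl : Metric.closedBall (t : ℂ) (t / 200) ⊆ Metric.ball (t : ℂ) (t / 100) :=
    Metric.closedBall_subset_ball (by linarith)
  have hit := FG.iter_re Metric.isOpen_ball hd hf n t (Metric.mem_ball_self (by linarith))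
  have hC := Complex.norm_iteratedDeriv_le_of_forall_mem_sphere_norm_le n
    (show 0 < t / 200 by linarith) (hd.diffContOnCl_ball hcl)
    (fun z hz => hb z (hcl (Metric.sphere_subset_closedBall hz)))
  rw [hit, abs_mul, abs_of_pos (by positivity)]
  have htn : 0 < t ^ n := by positivity
  calc t ^ n * |(iteratedDeriv n H t).re|
      ≤ t ^ n * (n.factorial * Real.exp (-π * t * (∑ j, ξ j ^ 2) / 10) / (t / 200) ^ n) := by
        gcongr
        exact (Complex.abs_re_le_norm _).trans hC
    _ = n.factorial * 200 ^ n * Real.exp (-π * t * (∑ j, ξ j ^ 2) / 10) := by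
        rw [div_pow]; field_simp
    _ ≤ _ := by
        gcongr ?_ * Real.exp ?_
        have h1 : (2 : ℝ)⁻¹ ^ n ≤ 1 := pow_le_one₀ (by norm_num) (by norm_num)
        have h2 : 0 ≤ π * t * ∑ j, ξ j ^ 2 := by
          have := Finset.sum_nonneg (s := Finset.univ) (fun j _ => sq_nonneg (ξ j))
          have := Real.pi_pos
          positivity
        nlinarith
end

section
/- For every fixed D > 0 there exists a constant c_D > 0, independent of the dimension d ∈ ℤ_+, such that for all d ∈ ℤ_+, all ξ ∈ 𝕋^d and all t with 0 < t ≤ D one has F_{ℤ^d} g_t(ξ) ≤ exp( -c_D e^{-π/t} |ξ|² ). -/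
open scoped ENNReal Real BigOperators
open Real

lemma summable_aux (s : ℝ) (hs : 0 < s) :
    Summable (fun n : ℤ => Real.exp (-π * (n : ℝ) ^ 2 / s)) := by
  have h := summable_pow_mul_jacobiTheta₂_term_bound 0 (T := 1 / s) (by positivity) 0
  refine h.congr fun n => ?_
  rw [pow_zero, one_mul]
  congr 1
  ring

noncomputable def sAux (t ζ : ℝ) : ℝ :=
  ∑' n : ℤ, Real.exp (-π * (n : ℝ) ^ 2 / t) * Real.cos (2 * π * n * ζ)

lemma summable_cos (t ζ : ℝ) (ht : 0 < t) :
    Summable (fun n : ℤ => Real.exp (-π * (n : ℝ) ^ 2 / t) * Real.cos (2 * π * n * ζ)) := by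
  refine Summable.of_norm_bounded (summable_aux t ht) fun n => ?_
  rw [norm_mul, Real.norm_eq_abs, Real.norm_eq_abs, abs_of_pos (Real.exp_pos _)]
  exact mul_le_of_le_one_right (Real.exp_pos _).le (Real.abs_cos_le_one _)

lemma poisson_aux (t ζ : ℝ) (ht : 0 < t) : sAux t ζ = Real.sqrt t * theta t ζ := by
  have key := Complex.tsum_exp_neg_quadratic (a := ((1 / t : ℝ) : ℂ))
    (by rw [Complex.ofReal_re]; positivity) (Complex.I * ζ)
  have hre : ∀ n : ℤ, (Complex.exp (-π * ((1 / t : ℝ) : ℂ) * n ^ 2 +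
      2 * π * (Complex.I * ζ) * n)).re =
      Real.exp (-π * (n : ℝ) ^ 2 / t) * Real.cos (2 * π * n * ζ) := by
    intro n
    have : (-π * ((1 / t : ℝ) : ℂ) * n ^ 2 + 2 * π * (Complex.I * ζ) * n : ℂ) =
        ((-π * (n : ℝ) ^ 2 / t : ℝ) : ℂ) + ((2 * π * n * ζ : ℝ) : ℂ) * Complex.I := by
      push_cast; ring
    rw [this, Complex.exp_re]
    simp only [Complex.add_re, Complex.add_im, Complex.ofReal_re, Complex.ofReal_im,
      Complex.re_ofReal_mul, Complex.im_ofReal_mul, Complex.I_re, Complex.I_im]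
    simp
  have hs : Summable (fun n : ℤ => Complex.exp (-π * ((1 / t : ℝ) : ℂ) * n ^ 2 +
      2 * π * (Complex.I * ζ) * n)) := by
    refine Summable.of_norm ((summable_aux t ht).congr fun n => ?_)
    rw [Complex.norm_exp]
    congr 1
    have : (-π * ((1 / t : ℝ) : ℂ) * n ^ 2 + 2 * π * (Complex.I * ζ) * n : ℂ) =
        ((-π * (n : ℝ) ^ 2 / t : ℝ) : ℂ) + ((2 * π * n * ζ : ℝ) : ℂ) * Complex.I := by
      push_cast; ring
    rw [this, Complex.add_re, Complex.re_ofReal_mul, Complex.I_re, Complex.ofReal_re]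
    ring
  have h1 : sAux t ζ = (∑' n : ℤ, Complex.exp (-π * ((1 / t : ℝ) : ℂ) * n ^ 2 +
      2 * π * (Complex.I * ζ) * n)).re := by
    rw [Complex.re_tsum hs]
    exact tsum_congr fun n => (hre n).symm
  have h2 : (∑' n : ℤ, Complex.exp (-π / ((1 / t : ℝ) : ℂ) *
      (n + Complex.I * (Complex.I * ζ)) ^ 2)) = ((theta t ζ : ℝ) : ℂ) := by
    rw [theta, Complex.ofReal_tsum]
    refine tsum_congr fun n => ?_
    rw [Complex.ofReal_exp]
    congr 1
    rw [← mul_assoc, Complex.I_mul_I]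
    push_cast
    have : (t : ℂ) ≠ 0 := by exact_mod_cast ht.ne'
    field_simp
    ring
  have h3 : (1 : ℂ) / (((1 / t : ℝ) : ℂ) ^ (1 / 2 : ℂ)) = ((Real.sqrt t : ℝ) : ℂ) := by
    have : (((1 / t : ℝ) : ℂ) ^ (1 / 2 : ℂ)) = (((1 / t) ^ (1 / 2 : ℝ) : ℝ) : ℂ) := by
      rw [Complex.ofReal_cpow (by positivity)]
      norm_num
    rw [this, ← Real.sqrt_eq_rpow]
    simp
  rw [h1, key, h2, h3, ← Complex.ofReal_mul, Complex.ofReal_re]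

lemma ratio_aux (D t ζ : ℝ) (ht : 0 < t) (htD : t ≤ D) (hζ : ζ ∈ Set.Ico (-(1/2) : ℝ) (1/2)) :
    theta t ζ / theta t 0 ≤ Real.exp (-(8 / sAux D 0) * Real.exp (-π / t) * ζ ^ 2) := by
  have hD : 0 < D := ht.trans_le htD
  have hs0 : ∀ s : ℝ, sAux s 0 = ∑' n : ℤ, Real.exp (-π * (n : ℝ) ^ 2 / s) := by
    intro s; simp [sAux]
  have hpos : 0 < sAux t 0 := by
    rw [hs0]
    exact (summable_aux t ht).tsum_pos (fun n => (Real.exp_pos _).le) 0 (Real.exp_pos _)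
  have hmono : sAux t 0 ≤ sAux D 0 := by
    rw [hs0, hs0]
    refine (summable_aux t ht).tsum_le_tsum (fun n => ?_) (summable_aux D hD)
    apply Real.exp_le_exp.2
    rw [neg_mul, neg_div, neg_div]
    apply neg_le_neg
    gcongr
  have hdiff : Real.exp (-π / t) * (8 * ζ ^ 2) ≤ sAux t 0 - sAux t ζ := by
    rw [hs0, sAux, ← (summable_aux t ht).tsum_sub (summable_cos t ζ ht)]
    have h := ((summable_aux t ht).sub (summable_cos t ζ ht)).le_tsum (1 : ℤ) (fun n _ => by
      have := Real.cos_le_one (2 * π * n * ζ)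
      have := Real.exp_pos (-π * (n : ℝ) ^ 2 / t)
      nlinarith)
    refine le_trans ?_ h
    have hc := Real.cos_le_one_sub_mul_cos_sq (x := 2 * π * ζ) (by
      rw [abs_le]; constructor <;> nlinarith [Real.pi_pos, hζ.1, hζ.2])
    have e : 2 / π ^ 2 * (2 * π * ζ) ^ 2 = 8 * ζ ^ 2 := by
      field_simp [Real.pi_ne_zero]; ring
    rw [e] at hc
    have := Real.exp_pos (-π / t)
    simp only [Int.cast_one, one_pow, mul_one]
    nlinarith
  have hr : theta t ζ / theta t 0 = sAux t ζ / sAux t 0 := by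
    rw [poisson_aux t ζ ht, poisson_aux t 0 ht,
      mul_div_mul_left _ _ (Real.sqrt_pos.2 ht).ne']
  rw [hr]
  have h1 : sAux t ζ / sAux t 0 ≤ 1 - Real.exp (-π / t) * (8 * ζ ^ 2) / sAux t 0 := by
    rw [div_le_iff₀ hpos, sub_mul, div_mul_cancel₀ _ hpos.ne']
    linarith
  have h2 : Real.exp (-π / t) * (8 * ζ ^ 2) / sAux D 0 ≤
      Real.exp (-π / t) * (8 * ζ ^ 2) / sAux t 0 := by
    gcongr
  have h3 := Real.add_one_le_exp (-(8 / sAux D 0) * Real.exp (-π / t) * ζ ^ 2)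
  have e : -(8 / sAux D 0) * Real.exp (-π / t) * ζ ^ 2 =
      -(Real.exp (-π / t) * (8 * ζ ^ 2) / sAux D 0) := by ring
  linarith

/-- Estimate at infinity, small scales: for every `D > 0` there is `c_D > 0`, independent of the
dimension `d`, such that for all `d ∈ ℤ_+`, `ξ ∈ 𝕋^d` and `0 < t ≤ D` one has
`F_{ℤ^d} g_t(ξ) = Θ_t(ξ)/Θ_t(0) ≤ exp(-c_D e^{-π/t} |ξ|²)`. -/
theorem fourier_gauss_small_scales (D : ℝ) (hD : 0 < D) :
    ∃ c : ℝ, 0 < c ∧ ∀ d : ℕ, 0 < d → ∀ ξ : Fin d → ℝ,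
      (∀ j, ξ j ∈ Set.Ico (-(1/2) : ℝ) (1/2)) → ∀ t : ℝ, 0 < t → t ≤ D →
      bigTheta d t ξ / bigTheta d t 0 ≤
        Real.exp (-c * Real.exp (-π / t) * ∑ j, ξ j ^ 2) := by
  refine ⟨8 / sAux D 0, ?_, ?_⟩
  · have : 0 < sAux D 0 := by
      have e : sAux D 0 = ∑' n : ℤ, Real.exp (-π * (n : ℝ) ^ 2 / D) := by simp [sAux]
      rw [e]
      exact (summable_aux D hD).tsum_pos (fun n => (Real.exp_pos _).le) 0 (Real.exp_pos _)
    positivity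
  · intro d _ ξ hξ t ht htD
    have hn : ∀ z : ℝ, 0 ≤ theta t z := fun z => tsum_nonneg fun k => (Real.exp_pos _).le
    rw [bigTheta, bigTheta, ← Finset.prod_div_distrib, Finset.mul_sum, Real.exp_sum]
    exact Finset.prod_le_prod (fun j _ => div_nonneg (hn _) (hn _))
      (fun j _ => ratio_aux D t (ξ j) ht htD (hξ j))
end

section
/- For each n ∈ ℤ_+ and each fixed D > 0 there exists a constant C_{n,D} > 0 such that for all t with 0 < t ≤ D and all ξ ∈ 𝕋 one has | ∂_t^n ( θ_t(ξ)/θ_t(0) ) | ≤ C_{n,D} · t^{-2n} e^{-π/t} ξ² · exp( -e^{-π/t} ξ² ), where ∂_t^n denotes the n-th derivative in t of the smooth function t ↦ θ_t(ξ)/θ_t(0) on (0,∞). -/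
open scoped ENNReal Real BigOperators
open Real

lemma aux_transfer (U : Set ℂ) (hU : IsOpen U) (n : ℕ) :
    ∀ (f : ℝ → ℝ) (g : ℂ → ℂ), DifferentiableOn ℂ g U →
      (∀ s : ℝ, (s : ℂ) ∈ U → f s = (g s).re) →
      ∀ s : ℝ, (s : ℂ) ∈ U → iteratedDeriv n f s = (iteratedDeriv n g s).re := by
  induction n with
  | zero => intro f g _ h s hs; simpa using h s hs
  | succ k ih =>
    intro f g hg h s hs
    rw [iteratedDeriv_succ', iteratedDeriv_succ']
    refine ih _ _ (hg.deriv hU) ?_ s hs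
    intro x hx
    have h1 := ((hg.differentiableAt (hU.mem_nhds hx)).hasDerivAt).real_of_complex
    have h2 : f =ᶠ[nhds x] fun y : ℝ => (g y).re := by
      have := (Complex.continuous_ofReal.tendsto x).eventually (hU.mem_nhds hx)
      filter_upwards [this] with y hy using h y hy
    rw [h2.deriv_eq, h1.deriv]

lemma aux_theta (s ξ : ℝ) (hs : 0 < s) :
    jacobiTheta₂ ξ (Complex.I / s) = 1 / ((1 / s : ℂ)) ^ (1 / 2 : ℂ) * (theta s ξ : ℂ) := by
  have ha : 0 < (1 / s : ℂ).re := by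
    rw [← Complex.ofReal_one, ← Complex.ofReal_div, Complex.ofReal_re]; positivity
  have hs' : (s : ℂ) ≠ 0 := by exact_mod_cast hs.ne'
  have := Complex.tsum_exp_neg_quadratic ha (Complex.I * ξ)
  have e1 : jacobiTheta₂ ξ (Complex.I / s) =
      ∑' n : ℤ, Complex.exp (-π * (1 / s : ℂ) * n ^ 2 + 2 * π * (Complex.I * ξ) * n) := by
    unfold jacobiTheta₂ jacobiTheta₂_term
    congr 1; ext n; congr 1
    field_simp
    ring_nf
    simp only [Complex.I_sq]; ring
  rw [e1, this]
  congr 1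
  unfold theta
  rw [Complex.ofReal_tsum]
  congr 1; ext n
  push_cast
  congr 1
  have : (n + Complex.I * (Complex.I * ξ) : ℂ) = n - ξ := by
    rw [← mul_assoc, Complex.I_mul_I]; ring
  rw [this]
  field_simp

lemma aux_ratio (s ξ : ℝ) (hs : 0 < s) :
    ((theta s ξ / theta s 0 : ℝ) : ℂ) =
      jacobiTheta₂ ξ (Complex.I / s) / jacobiTheta₂ 0 (Complex.I / s) := by
  have h0 := aux_theta s 0 hs
  rw [Complex.ofReal_zero] at h0
  rw [aux_theta s ξ hs, h0, mul_div_mul_left, Complex.ofReal_div]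
  have hs' : (s : ℂ) ≠ 0 := by exact_mod_cast hs.ne'
  simp [Complex.cpow_eq_zero_iff, hs']

lemma aux_summable (T : ℝ) (hT : 0 < T) :
    Summable (fun n : ℤ => (n : ℝ) ^ 2 * Real.exp (-π * (n : ℝ) ^ 2 * T)) := by
  have := summable_pow_mul_jacobiTheta₂_term_bound 0 hT 2
  refine this.congr fun n => ?_
  congr 1
  · simp
  · congr 1; ring

lemma aux_P (T u δ : ℝ) (hT : 0 < T) (hu : 2 * T ≤ u) (hδ : δ ≤ T) (τ : ℂ)
    (hτ : ‖τ - Complex.I * u‖ ≤ δ) :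
    ‖jacobiTheta₂ 0 τ - jacobiTheta₂ 0 (Complex.I * u)‖ ≤
      π * δ * ∑' n : ℤ, (n : ℝ) ^ 2 * Real.exp (-π * (n : ℝ) ^ 2 * T) := by
  have him : u - δ ≤ τ.im := by
    have := (Complex.abs_im_le_norm _).trans hτ
    simp at this
    linarith [(abs_le.1 this).1]
  have h1 := hasSum_jacobiTheta₂_term 0 (τ := τ) (by linarith)
  have h2 := hasSum_jacobiTheta₂_term 0 (τ := Complex.I * u) (by simp; linarith)
  rw [← tsum_mul_left]
  refine (h1.sub h2).norm_le_of_bounded ((aux_summable T hT).mul_left (π * δ)).hasSum ?_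
  intro n
  have hδ0 : 0 ≤ δ := (norm_nonneg _).trans hτ
  set x : ℂ := π * Complex.I * n ^ 2 * (τ - Complex.I * u) with hx
  have e : jacobiTheta₂_term n 0 τ - jacobiTheta₂_term n 0 (Complex.I * u) =
      jacobiTheta₂_term n 0 (Complex.I * u) * (Complex.exp x - 1) := by
    unfold jacobiTheta₂_term
    rw [mul_sub, ← Complex.exp_add, mul_one]
    congr 2
    rw [hx]; ring
  have hxn : ‖x‖ ≤ π * (n : ℝ) ^ 2 * δ := by
    rw [hx]
    simp only [norm_mul, norm_pow, Complex.norm_I, Complex.norm_intCast, Complex.norm_real,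
      Real.norm_eq_abs, abs_of_pos Real.pi_pos, mul_one, sq_abs]
    gcongr
  have hb : ‖Complex.exp x - 1‖ ≤ ‖x‖ * Real.exp ‖x‖ := by
    simpa using Complex.norm_exp_sub_sum_le_norm_mul_exp x 1
  rw [e, norm_mul, norm_jacobiTheta₂_term]
  calc _ ≤ Real.exp (-π * n ^ 2 * u) *
        ((π * (n : ℝ) ^ 2 * δ) * Real.exp (π * (n : ℝ) ^ 2 * δ)) := by
        have : (-π * n ^ 2 * (Complex.I * u).im - 2 * π * n * (0 : ℂ).im) = -π * n ^ 2 * u := by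
          simp
        rw [this]
        gcongr
        exact hb.trans (by gcongr)
    _ = π * δ * ((n : ℝ) ^ 2 * (Real.exp (-π * n ^ 2 * u) * Real.exp (π * (n : ℝ) ^ 2 * δ))) := by
        ring
    _ ≤ _ := by
        rw [← Real.exp_add]
        gcongr
        have : 0 ≤ π * (n : ℝ) ^ 2 * (u - δ - T) := by
          apply mul_nonneg (by positivity); linarith
        linarith

lemma aux_N (T u : ℝ) (hT : 0 < T) (hu : 2 * T ≤ u) (τ : ℂ)
    (hτ : u - T ≤ τ.im) (ξ : ℝ) :
    ‖jacobiTheta₂ 0 τ - jacobiTheta₂ ξ τ‖ ≤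
      2 * π ^ 2 * ξ ^ 2 * Real.exp (2 * π * T) * Real.exp (-π * u) *
        ∑' n : ℤ, (n : ℝ) ^ 2 * Real.exp (-π * (n : ℝ) ^ 2 * T) := by
  have h0 := hasSum_jacobiTheta₂_term 0 (τ := τ) (by linarith)
  have h1 := hasSum_jacobiTheta₂_term ξ (τ := τ) (by linarith)
  have h2 := hasSum_jacobiTheta₂_term (-ξ) (τ := τ) (by linarith)
  rw [jacobiTheta₂_neg_left] at h2
  have h3 := h0.sub ((h1.add h2).div_const 2)
  rw [add_self_div_two] at h3
  rw [← tsum_mul_left]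
  refine h3.norm_le_of_bounded ((aux_summable T hT).mul_left _).hasSum ?_
  intro n
  have e : jacobiTheta₂_term n 0 τ - (jacobiTheta₂_term n ξ τ + jacobiTheta₂_term n (-ξ) τ) / 2 =
      jacobiTheta₂_term n 0 τ * ((1 - Real.cos (2 * π * n * ξ) : ℝ) : ℂ) := by
    unfold jacobiTheta₂_term
    push_cast
    rw [Complex.cos, Complex.exp_add, Complex.exp_add, Complex.exp_add]
    have a1 : 2 * (π : ℂ) * Complex.I * n * ξ = 2 * π * n * ξ * Complex.I := by ring
    have a2 : 2 * (π : ℂ) * Complex.I * n * -ξ = -(2 * π * n * ξ) * Complex.I := by ring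
    rw [a1, a2]
    simp only [mul_zero, Complex.exp_zero]
    ring
  have hc : |1 - Real.cos (2 * π * n * ξ)| ≤ 2 * π ^ 2 * ξ ^ 2 * (n : ℝ) ^ 2 := by
    rw [abs_of_nonneg (by linarith [Real.cos_le_one (2 * π * n * ξ)])]
    have := Real.one_sub_sq_div_two_le_cos (x := 2 * π * n * ξ)
    nlinarith
  rw [e, norm_mul, norm_jacobiTheta₂_term, Complex.norm_real, Real.norm_eq_abs]
  have e2 : (-π * n ^ 2 * τ.im - 2 * π * n * (0 : ℂ).im) = -π * n ^ 2 * τ.im := by simp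
  rw [e2]
  by_cases hn : n = 0
  · subst hn; simp
  have hn1 : (1 : ℝ) ≤ (n : ℝ) ^ 2 := by
    have : (1 : ℤ) ≤ n ^ 2 := by have := sq_nonneg n; have : n ^ 2 ≠ 0 := by positivity
                                 omega
    exact_mod_cast this
  calc _ ≤ Real.exp (2 * π * T + -π * u + -π * n ^ 2 * T) * (2 * π ^ 2 * ξ ^ 2 * (n : ℝ) ^ 2) := by
        gcongr
        have : 0 ≤ π * (((n : ℝ) ^ 2 - 1) * (u - 2 * T) + (n : ℝ) ^ 2 * (τ.im - (u - T))) := by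
          apply mul_nonneg Real.pi_pos.le
          apply add_nonneg <;> apply mul_nonneg <;> nlinarith
        nlinarith
    _ = _ := by rw [Real.exp_add, Real.exp_add]; ring

lemma aux_P_ge (u : ℝ) (hu : 0 < u) : 1 ≤ ‖jacobiTheta₂ 0 (Complex.I * u)‖ := by
  have h2 := hasSum_jacobiTheta₂_term 0 (τ := Complex.I * u) (by simpa)
  have h3 := Complex.hasSum_re h2
  refine le_trans ?_ (Complex.re_le_norm _)
  have e : ∀ n : ℤ, (jacobiTheta₂_term n 0 (Complex.I * u)).re = Real.exp (-π * n ^ 2 * u) := by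
    intro n
    have : jacobiTheta₂_term n 0 (Complex.I * u) = ((Real.exp (-π * n ^ 2 * u) : ℝ) : ℂ) := by
      unfold jacobiTheta₂_term
      push_cast
      congr 1
      ring_nf
      simp only [Complex.I_sq]; ring
    rw [this, Complex.ofReal_re]
  simp only [e] at h3
  have := le_hasSum h3 0 (fun n _ => (Real.exp_pos _).le)
  simpa using this

/-- Derivative bounds for the ratio `θ_t(ξ)/θ_t(0)` at small scales: for each `n ∈ ℤ_+` and each
fixed `D > 0` there is `C_{n,D} > 0` such that for all `0 < t ≤ D` and `ξ ∈ 𝕋`,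
`|∂_t^n (θ_t(ξ)/θ_t(0))| ≤ C_{n,D} t^{-2n} e^{-π/t} ξ² exp(-e^{-π/t} ξ²)`. -/
theorem theta_ratio_deriv_small_scales (n : ℕ) (hn : 0 < n) (D : ℝ) (hD : 0 < D) :
    ∃ C : ℝ, 0 < C ∧ ∀ t : ℝ, 0 < t → t ≤ D → ∀ ξ : ℝ, ξ ∈ Set.Ico (-(1/2) : ℝ) (1/2) →
      |iteratedDeriv n (fun s => theta s ξ / theta s 0) t| ≤
        C * (t ^ (2 * n))⁻¹ * Real.exp (-π / t) * ξ ^ 2 *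
          Real.exp (-Real.exp (-π / t) * ξ ^ 2) := by
  set T : ℝ := 1 / (2 * D) with hTd
  have hT : 0 < T := by positivity
  set S : ℝ := ∑' n : ℤ, (n : ℝ) ^ 2 * Real.exp (-π * (n : ℝ) ^ 2 * T) with hS
  have hS0 : 0 ≤ S := tsum_nonneg fun n => by positivity
  have hpi := Real.pi_pos
  set δ : ℝ := min T (1 / (2 * (π * S + 1))) with hδd
  have hδ : 0 < δ := by positivity
  have hδT : δ ≤ T := min_le_left _ _
  have hδS : π * δ * S ≤ 1 / 2 := by
    have h : δ ≤ 1 / (2 * (π * S + 1)) := min_le_right _ _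
    rw [le_div_iff₀ (by positivity)] at h
    nlinarith
  set c : ℝ := δ / 2 with hc
  have hc0 : 0 < c := by positivity
  set M : ℝ := 4 * π ^ 2 * Real.exp (2 * π * T) * (S + 1) with hM
  have hM0 : 0 < M := by positivity
  refine ⟨n.factorial * M / c ^ n * Real.exp 1, by positivity, ?_⟩
  intro t ht htD ξ hξ
  have hu : 2 * T ≤ 1 / t := by
    rw [hTd, le_div_iff₀ ht]; field_simp; linarith
  have hr0 : 0 < c * t ^ 2 := by positivity
  have hrt : c * t ^ 2 ≤ t / 2 := by
    have : 2 * T * t ≤ 1 := by rwa [le_div_iff₀ ht] at hu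
    have h2 : c * t ≤ 1 / 2 := by
      have : δ * t ≤ T * t := by gcongr
      rw [hc]; nlinarith
    nlinarith
  -- geometry of the ball
  have hre : ∀ z ∈ Metric.closedBall (t : ℂ) (c * t ^ 2), 0 < z.re ∧
      ‖Complex.I / z - Complex.I * ((1 / t : ℝ) : ℂ)‖ ≤ δ := by
    intro z hz
    rw [mem_closedBall_iff_norm] at hz
    have h1 := (Complex.abs_re_le_norm _).trans hz
    simp only [Complex.sub_re, Complex.ofReal_re] at h1
    have h2 := (abs_le.1 h1).1
    have hz0 : 0 < z.re := by linarith
    refine ⟨hz0, ?_⟩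
    have hzn : t / 2 ≤ ‖z‖ := by linarith [Complex.re_le_norm z]
    have hzne : z ≠ 0 := by rintro rfl; simp at hz0
    have htne : (t : ℂ) ≠ 0 := by exact_mod_cast ht.ne'
    have e : Complex.I / z - Complex.I * ((1 / t : ℝ) : ℂ) = -Complex.I * (z - t) / (z * t) := by
      push_cast; field_simp; ring
    rw [e, norm_div, norm_mul, norm_mul, norm_neg, Complex.norm_I, one_mul, Complex.norm_real,
      Real.norm_eq_abs, abs_of_pos ht, div_le_iff₀ (by positivity)]
    refine hz.trans ?_
    rw [hc]
    have : t / 2 * t ≤ ‖z‖ * t := by gcongr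
    nlinarith
  have him : ∀ z ∈ Metric.closedBall (t : ℂ) (c * t ^ 2), 1 / t - T ≤ (Complex.I / z).im := by
    intro z hz
    have h := (Complex.abs_im_le_norm _).trans (hre z hz).2
    have e : (Complex.I / z - Complex.I * ((1 / t : ℝ) : ℂ)).im = (Complex.I / z).im - 1 / t := by
      rw [Complex.sub_im, Complex.I_mul_im, Complex.ofReal_re]
    rw [e] at h
    linarith [(abs_le.1 h).1]
  have hP : ∀ z ∈ Metric.closedBall (t : ℂ) (c * t ^ 2),
      1 / 2 ≤ ‖jacobiTheta₂ 0 (Complex.I / z)‖ := by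
    intro z hz
    have h1 := aux_P T (1 / t) δ hT hu hδT _ (hre z hz).2
    have h2 := aux_P_ge (1 / t) (by positivity)
    have h3 := norm_sub_norm_le (jacobiTheta₂ 0 (Complex.I * ((1 / t : ℝ) : ℂ)))
      (jacobiTheta₂ 0 (Complex.I / z))
    rw [norm_sub_rev] at h3
    linarith
  have hPne : ∀ z ∈ Metric.closedBall (t : ℂ) (c * t ^ 2), jacobiTheta₂ 0 (Complex.I / z) ≠ 0 := by
    intro z hz h
    have := hP z hz
    rw [h, norm_zero] at this
    linarith
  set g : ℂ → ℂ := fun z => (jacobiTheta₂ ξ (Complex.I / z) - jacobiTheta₂ 0 (Complex.I / z)) /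
    jacobiTheta₂ 0 (Complex.I / z) with hg
  have hdiff : DifferentiableOn ℂ g (Metric.closedBall (t : ℂ) (c * t ^ 2)) := by
    intro z hz
    apply DifferentiableAt.differentiableWithinAt
    have hi : 0 < (Complex.I / z).im := by linarith [him z hz]
    have hzne : z ≠ 0 := by rintro rfl; simp at hi
    have hd : DifferentiableAt ℂ (fun z : ℂ => Complex.I / z) z :=
      (differentiableAt_const _).div differentiableAt_id hzne
    have hJ : ∀ y : ℂ, DifferentiableAt ℂ (fun z : ℂ => jacobiTheta₂ y (Complex.I / z)) z :=
      fun y => (differentiableAt_jacobiTheta₂_snd y hi).comp z hd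
    exact ((hJ ξ).sub (hJ 0)).div (hJ 0) (hPne z hz)
  have hbound : ∀ z ∈ Metric.sphere (t : ℂ) (c * t ^ 2),
      ‖g z‖ ≤ M * Real.exp (-π / t) * ξ ^ 2 := by
    intro z hz
    have hz := Metric.sphere_subset_closedBall hz
    have h1 := aux_N T (1 / t) hT hu _ (him z hz) ξ
    rw [norm_sub_rev, ← hS] at h1
    rw [hg]
    simp only
    rw [norm_div, div_le_iff₀ (by linarith [hP z hz])]
    refine h1.trans ?_
    have e : -π * (1 / t) = -π / t := by ring
    rw [e]
    calc _ ≤ 2 * π ^ 2 * ξ ^ 2 * Real.exp (2 * π * T) * Real.exp (-π / t) * (S + 1) := by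
          gcongr; linarith
      _ = M * Real.exp (-π / t) * ξ ^ 2 * (1 / 2) := by rw [hM]; ring
      _ ≤ _ := by gcongr; exact hP z hz
  have hcauchy := Complex.norm_iteratedDeriv_le_of_forall_mem_sphere_norm_le n hr0
    (hdiff.diffContOnCl_ball le_rfl) hbound
  have htr := aux_transfer (Metric.ball (t : ℂ) (c * t ^ 2)) Metric.isOpen_ball n
    (fun s => -1 + theta s ξ / theta s 0) g (hdiff.mono Metric.ball_subset_closedBall) (by
      intro s hs
      have hs' := Metric.ball_subset_closedBall hs
      have hs0 : 0 < s := by simpa using (hre _ hs').1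
      have : g s = ((-1 + theta s ξ / theta s 0 : ℝ) : ℂ) := by
        rw [Complex.ofReal_add, aux_ratio s ξ hs0, hg]
        simp only
        rw [sub_div, div_self (hPne _ hs')]
        push_cast; ring
      rw [this, Complex.ofReal_re]) t (Metric.mem_ball_self hr0)
  rw [iteratedDeriv_const_add hn] at htr
  rw [htr]
  refine (Complex.abs_re_le_norm _).trans (hcauchy.trans ?_)
  have hξ2 : ξ ^ 2 ≤ 1 := by nlinarith [hξ.1, hξ.2]
  have he1 : Real.exp (-π / t) ≤ 1 := by
    rw [Real.exp_le_one_iff, neg_div]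
    have : 0 < π / t := by positivity
    linarith
  have hone : 1 ≤ Real.exp 1 * Real.exp (-Real.exp (-π / t) * ξ ^ 2) := by
    rw [← Real.exp_add]
    apply Real.one_le_exp
    have : Real.exp (-π / t) * ξ ^ 2 ≤ 1 := mul_le_one₀ he1 (sq_nonneg _) hξ2
    linarith
  calc _ = (n.factorial * M / c ^ n * (t ^ (2 * n))⁻¹ * Real.exp (-π / t) * ξ ^ 2) * 1 := by
        rw [mul_pow, ← pow_mul]; field_simp
    _ ≤ (n.factorial * M / c ^ n * (t ^ (2 * n))⁻¹ * Real.exp (-π / t) * ξ ^ 2) *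
        (Real.exp 1 * Real.exp (-Real.exp (-π / t) * ξ ^ 2)) := by gcongr
    _ = _ := by ring
end
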